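/- Let sigma and sigma' be weights of K. If chi_{sigma'} is neither chi_sigma nor chi_sigma^s, then the space of G-equivariant maps Hom_G(ind_K^G sigma, ind_K^G sigma') is zero. -/

import Mathlib

open scoped Classical

noncomputable section

namespace U21

/-- The arithmetic setting: `E` is the unramified quadratic extension of a non-archimedean
local field `F` of odd residue characteristic `p`, with residue field of `F` of cardinality
`q = p ^ fdeg`.  The field `E` is encoded through its valuation subring `O = o_E`, a
uniformizer `ϖ`, the maximal ideal `mI` (so that `p_E^k` is `ϖ ^ k * O`), and the nontrivial
`F`-automorphism `conj` of `E` (which induces the `q`-power Frobenius on the residue field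
of `E`, of cardinality `q ^ 2`). -/
structure Setting where
  p : ℕ
  q : ℕ
  fdeg : ℕ
  hp : p.Prime
  hodd : p ≠ 2
  hfdeg : 0 < fdeg
  hq : q = p ^ fdeg
  E : Type
  [fieldE : Field E]
  conj : E →+* E
  conj_invol : ∀ x, conj (conj x) = x
  conj_ne : conj ≠ RingHom.id E
  O : Subring E
  val_ring : ∀ x : E, x ≠ 0 → x ∈ O ∨ x⁻¹ ∈ O
  conj_O : ∀ x, x ∈ O → conj x ∈ O
  ϖ : E
  unif_mem : ϖ ∈ O
  unif_ne : ϖ ≠ 0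
  unif_conj : conj ϖ = ϖ
  unif_not_unit : ¬ IsUnit (⟨ϖ, unif_mem⟩ : O)
  disc : ∀ x : E, x ≠ 0 → ∃ (n : ℤ) (u : Oˣ), x = (u : O) * ϖ ^ n
  mI : Ideal O
  hmI : ∀ x : O, x ∈ mI ↔ ∃ y ∈ O, (x : E) = ϖ * y
  [fin_res : Fintype (O ⧸ mI)]
  card_res : Fintype.card (O ⧸ mI) = q ^ 2
  res_frob : ∀ x : O, Ideal.Quotient.mk mI ⟨conj x, conj_O x x.2⟩ = (Ideal.Quotient.mk mI x) ^ q
  complete : ∀ a : ℕ → E,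
    (∀ k : ℕ, ∃ N, ∀ m ≥ N, ∀ n ≥ N, ∃ w ∈ O, a m - a n = ϖ ^ k * w) →
    ∃ L : E, ∀ k : ℕ, ∃ N, ∀ n ≥ N, ∃ w ∈ O, a n - L = ϖ ^ k * w

attribute [instance] Setting.fieldE Setting.fin_res

namespace Setting

variable (S : Setting)

/-- 3×3 matrices over `E`. -/
abbrev M3 := Matrix (Fin 3) (Fin 3) S.E

/-- The antidiagonal matrix `β` of the Hermitian form. -/
def betaM : S.M3 := !![0,0,1;0,1,0;1,0,0]

/-- The fractional ideal `p_E ^ k ⊆ E` (for `k : ℤ`). -/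
def pE (k : ℤ) : Set S.E := {z | ∃ w ∈ S.O, z = S.ϖ ^ k * w}

/-- The unramified unitary group `G = U(2,1)(E/F)`, as a subgroup of `GL₃(E)`:
`g ∈ G` iff `g.transpose * β * conj g = β`. -/
def Gsub : Subgroup (Matrix.GeneralLinearGroup (Fin 3) S.E) where
  carrier := {g | ((g : S.M3)).transpose * S.betaM * ((g : S.M3).map S.conj) = S.betaM}
  one_mem' := by
    simp [Matrix.map_one (⇑S.conj) (map_zero S.conj) (map_one S.conj)]
  mul_mem' := by
    intro a b ha hb
    simp only [Set.mem_setOf_eq, Units.val_mul, Matrix.transpose_mul, Matrix.map_mul] at ha hb ⊢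
    calc ((b : S.M3)).transpose * ((a : S.M3)).transpose * S.betaM * ((a : S.M3).map S.conj * (b : S.M3).map S.conj)
        = ((b : S.M3)).transpose * (((a : S.M3)).transpose * S.betaM * (a : S.M3).map S.conj) * ((b : S.M3).map S.conj) := by
          simp only [mul_assoc]
      _ = S.betaM := by rw [ha]; exact hb
  inv_mem' := by
    intro a ha
    simp only [Set.mem_setOf_eq] at ha ⊢
    have hA : IsUnit ((a : S.M3)) := a.isUnit
    have hdet : IsUnit ((a : S.M3)).det := (Matrix.isUnit_iff_isUnit_det _).mp hA
    have hAc : IsUnit (((a : S.M3)).map ⇑S.conj) := by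
      rw [← RingHom.mapMatrix_apply]; exact hA.map _
    have hdetc : IsUnit ((((a : S.M3)).map ⇑S.conj).det) := (Matrix.isUnit_iff_isUnit_det _).mp hAc
    have hdetT : IsUnit ((((a : S.M3)).transpose).det) := by rw [Matrix.det_transpose]; exact hdet
    have hmapinv : ((a : S.M3)⁻¹).map ⇑S.conj = (((a : S.M3)).map ⇑S.conj)⁻¹ := by
      symm
      apply Matrix.inv_eq_left_inv
      rw [← Matrix.map_mul, Matrix.nonsing_inv_mul _ hdet,
        Matrix.map_one (⇑S.conj) (map_zero S.conj) (map_one S.conj)]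
    rw [Matrix.coe_units_inv, Matrix.transpose_nonsing_inv, hmapinv]
    conv_lhs => rw [← ha]
    calc (((a:S.M3)).transpose)⁻¹ * (((a:S.M3)).transpose * S.betaM * ((a:S.M3)).map ⇑S.conj) * (((a:S.M3)).map ⇑S.conj)⁻¹
        = (((a:S.M3)).transpose)⁻¹ * ((a:S.M3)).transpose * S.betaM *
            (((a:S.M3)).map ⇑S.conj * (((a:S.M3)).map ⇑S.conj)⁻¹) := by simp only [mul_assoc]
      _ = S.betaM := by
          rw [Matrix.nonsing_inv_mul _ hdetT, Matrix.mul_nonsing_inv _ hdetc, one_mul, mul_one]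

/-- The group `G = U(2,1)(E/F)`. -/
abbrev GG := ↥S.Gsub

/-- The matrix of an element of `G`. -/
def mat (g : S.GG) : S.M3 := ((g : Matrix.GeneralLinearGroup (Fin 3) S.E) : S.M3)

/-- The upper unipotent matrix `n(x,y)`. -/
def nM (x y : S.E) : S.M3 := !![1, x, y; 0, 1, -S.conj x; 0, 0, 1]

/-- The lower unipotent matrix `n'(x,y)`. -/
def n'M (x y : S.E) : S.M3 := !![1, 0, 0; x, 1, 0; y, -S.conj x, 1]

/-- The diagonal matrix `h(x) = diag(x, -x̄x⁻¹, x̄⁻¹)`. -/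
def hM (x : S.E) : S.M3 := !![x, 0, 0; 0, -S.conj x * x⁻¹, 0; 0, 0, (S.conj x)⁻¹]

/-- The subgroup `N` of `G` (unipotent radical of the upper triangular Borel), as a set. -/
def Nset : Set S.GG := {g | ∃ x y : S.E, x * S.conj x + y + S.conj y = 0 ∧ S.mat g = S.nM x y}

/-- The subgroup `N_k = {n(x,y) : y ∈ p_E^k}`, as a set. -/
def Nk (k : ℤ) : Set S.GG :=
  {g | ∃ x y : S.E, x * S.conj x + y + S.conj y = 0 ∧ y ∈ S.pE k ∧ S.mat g = S.nM x y}

/-- The subgroup `N'` of `G`, as a set. -/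
def N'set : Set S.GG := {g | ∃ x y : S.E, x * S.conj x + y + S.conj y = 0 ∧ S.mat g = S.n'M x y}

/-- The subgroup `N'_k = {n'(x,y) : y ∈ p_E^k}`, as a set. -/
def N'k (k : ℤ) : Set S.GG :=
  {g | ∃ x y : S.E, x * S.conj x + y + S.conj y = 0 ∧ y ∈ S.pE k ∧ S.mat g = S.n'M x y}

/-- The diagonal subgroup `H` of `G`, as a set. -/
def Hset : Set S.GG := {g | ∃ a b c : S.E, S.mat g = !![a,0,0;0,b,0;0,0,c]}

/-- The hyperspecial maximal compact subgroup `K₀ = G ∩ GL₃(o_E)`, as a set. -/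
def K0set : Set S.GG := {g | ∀ i j, S.mat g i j ∈ S.O}

/-- The special (non-hyperspecial) maximal compact subgroup `K₁`, as a set. -/
def K1set : Set S.GG :=
  {g | S.mat g 0 0 ∈ S.O ∧ S.mat g 0 1 ∈ S.O ∧ S.mat g 0 2 ∈ S.pE (-1) ∧
       S.mat g 1 0 ∈ S.pE 1 ∧ S.mat g 1 1 ∈ S.O ∧ S.mat g 1 2 ∈ S.O ∧
       S.mat g 2 0 ∈ S.pE 1 ∧ S.mat g 2 1 ∈ S.pE 1 ∧ S.mat g 2 2 ∈ S.O}

/-- The Iwahori subgroup `I_{K₀}` (preimage of the Borel of `Γ_{K₀}`), as a set. -/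
def IK0 : Set S.GG :=
  {g | g ∈ S.K0set ∧ S.mat g 1 0 ∈ S.pE 1 ∧ S.mat g 2 0 ∈ S.pE 1 ∧ S.mat g 2 1 ∈ S.pE 1}

/-- The pro-p Iwahori subgroup `I_{1,K₀}`, as a set. -/
def I1K0 : Set S.GG :=
  {g | g ∈ S.IK0 ∧ S.mat g 0 0 - 1 ∈ S.pE 1 ∧ S.mat g 1 1 - 1 ∈ S.pE 1 ∧ S.mat g 2 2 - 1 ∈ S.pE 1}

/-- The opposite pro-p Iwahori subgroup `I'_{1,K₀}`, as a set. -/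
def I1'K0 : Set S.GG :=
  {g | g ∈ S.K0set ∧ S.mat g 0 1 ∈ S.pE 1 ∧ S.mat g 0 2 ∈ S.pE 1 ∧ S.mat g 1 2 ∈ S.pE 1 ∧
       S.mat g 0 0 - 1 ∈ S.pE 1 ∧ S.mat g 1 1 - 1 ∈ S.pE 1 ∧ S.mat g 2 2 - 1 ∈ S.pE 1}

/-- The maximal normal pro-p subgroup `K₀¹` of `K₀` (principal congruence subgroup), as a set. -/
def Kone0 : Set S.GG := {g | ∀ i j, S.mat g i j - (1 : S.M3) i j ∈ S.pE 1}

/-- The Iwahori subgroup `I_{K₁}`, as a set. -/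
def IK1 : Set S.GG := {g | g ∈ S.K1set ∧ S.mat g 2 0 ∈ S.pE 2}

/-- The pro-p Iwahori subgroup `I_{1,K₁}`, as a set. -/
def I1K1 : Set S.GG :=
  {g | g ∈ S.IK1 ∧ S.mat g 0 0 - 1 ∈ S.pE 1 ∧ S.mat g 1 1 - 1 ∈ S.pE 1 ∧ S.mat g 2 2 - 1 ∈ S.pE 1}

/-- The opposite pro-p Iwahori subgroup `I'_{1,K₁}`, as a set. -/
def I1'K1 : Set S.GG :=
  {g | g ∈ S.K1set ∧ S.mat g 0 2 ∈ S.O ∧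
       S.mat g 0 0 - 1 ∈ S.pE 1 ∧ S.mat g 1 1 - 1 ∈ S.pE 1 ∧ S.mat g 2 2 - 1 ∈ S.pE 1}

/-- The maximal normal pro-p subgroup `K₁¹` of `K₁`, as a set. -/
def Kone1 : Set S.GG :=
  {g | g ∈ S.K1set ∧ S.mat g 0 2 ∈ S.O ∧ S.mat g 2 0 ∈ S.pE 2 ∧
       S.mat g 0 0 - 1 ∈ S.pE 1 ∧ S.mat g 1 1 - 1 ∈ S.pE 1 ∧ S.mat g 2 2 - 1 ∈ S.pE 1}

/-- The congruence subgroup of level `n` (used to express smoothness), as a set. -/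
def cong (n : ℕ) : Set S.GG := {g | ∀ i j, S.mat g i j - (1 : S.M3) i j ∈ S.pE n}

def alphaM : S.M3 := !![S.ϖ⁻¹, 0, 0; 0, 1, 0; 0, 0, S.ϖ]

def alphaMinv : S.M3 := !![S.ϖ, 0, 0; 0, 1, 0; 0, 0, S.ϖ⁻¹]

lemma alpha_mul_inv : S.alphaM * S.alphaMinv = 1 := by
  ext i j
  fin_cases i <;> fin_cases j <;>
    simp [alphaM, alphaMinv, Matrix.mul_apply, Fin.sum_univ_three, Matrix.one_apply,
      Matrix.vecHead, Matrix.vecTail, inv_mul_cancel₀ S.unif_ne, mul_inv_cancel₀ S.unif_ne]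

lemma alpha_inv_mul : S.alphaMinv * S.alphaM = 1 := by
  ext i j
  fin_cases i <;> fin_cases j <;>
    simp [alphaM, alphaMinv, Matrix.mul_apply, Fin.sum_univ_three, Matrix.one_apply,
      Matrix.vecHead, Matrix.vecTail, inv_mul_cancel₀ S.unif_ne, mul_inv_cancel₀ S.unif_ne]

def alphaU : Matrix.GeneralLinearGroup (Fin 3) S.E :=
  ⟨S.alphaM, S.alphaMinv, S.alpha_mul_inv, S.alpha_inv_mul⟩

lemma alphaU_mem : S.alphaU ∈ S.Gsub := by
  show ((S.alphaU : S.M3)).transpose * S.betaM * ((S.alphaU : S.M3).map S.conj) = S.betaM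
  have : (S.alphaU : S.M3) = S.alphaM := rfl
  rw [this]
  ext i j
  fin_cases i <;> fin_cases j <;>
    simp [alphaM, betaM, Matrix.mul_apply, Fin.sum_univ_three, Matrix.map_apply,
      Matrix.transpose_apply, Matrix.vecHead, Matrix.vecTail, map_inv₀, S.unif_conj,
      inv_mul_cancel₀ S.unif_ne, mul_inv_cancel₀ S.unif_ne]

/-- The element `α = diag(ϖ⁻¹, 1, ϖ)` of `G`. -/
def alphaE : S.GG := ⟨S.alphaU, S.alphaU_mem⟩

lemma beta_mul_beta : S.betaM * S.betaM = 1 := by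
  ext i j
  fin_cases i <;> fin_cases j <;>
    simp [betaM, Matrix.mul_apply, Fin.sum_univ_three, Matrix.one_apply,
      Matrix.vecHead, Matrix.vecTail]

def betaU : Matrix.GeneralLinearGroup (Fin 3) S.E :=
  ⟨S.betaM, S.betaM, S.beta_mul_beta, S.beta_mul_beta⟩

lemma betaU_mem : S.betaU ∈ S.Gsub := by
  show ((S.betaU : S.M3)).transpose * S.betaM * ((S.betaU : S.M3).map S.conj) = S.betaM
  have : (S.betaU : S.M3) = S.betaM := rfl
  rw [this]
  ext i j
  fin_cases i <;> fin_cases j <;>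
    simp [betaM, Matrix.mul_apply, Fin.sum_univ_three, Matrix.map_apply, Matrix.transpose_apply,
      Matrix.vecHead, Matrix.vecTail]

/-- The element `β` of `G`. -/
def betaE : S.GG := ⟨S.betaU, S.betaU_mem⟩

/-- The element `β' = β * α⁻¹` of `G`. -/
def betaPr : S.GG := S.betaE * S.alphaE⁻¹

/-- A finite set `U` is a set of representatives for the cosets `A/B`. -/
def IsReps (A B : Set S.GG) (U : Finset S.GG) : Prop :=
  (↑U : Set S.GG) ⊆ A ∧ ∀ a ∈ A, ∃! u, u ∈ U ∧ a⁻¹ * u ∈ B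

/-- The residue field `k_E` of `E`. -/
abbrev kE := S.O ⧸ S.mI

/-- The residue map `o_E → k_E`. -/
def resmap : S.O →+* S.kE := Ideal.Quotient.mk S.mI

/-- The group `L_{q³} = {(x,t) ∈ k_E² : x x̄ + t + t̄ = 0}` (where `x̄ = x^q`). -/
def Lbig : Set (S.kE × S.kE) := {z | z.1 * z.1 ^ S.q + z.2 + z.2 ^ S.q = 0}

/-- The group `L_q = {(0,t) ∈ k_E² : t + t̄ = 0}`. -/
def Lsmall : Set (S.kE × S.kE) := {z | z.1 = 0 ∧ z.2 + z.2 ^ S.q = 0}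

/-- `L_{q^t}` for `t ∈ {1,3}`. -/
def Lof (t : ℕ) : Set (S.kE × S.kE) := if t = 3 then S.Lbig else S.Lsmall

end Setting

/-- A choice of one of the two maximal compact open subgroups `K ∈ {K₀, K₁}` of `G`,
together with its maximal normal pro-p subgroup `K¹`, the (pro-p) Iwahori subgroups
`I_K ⊇ I_{1,K}`, the opposite pro-p Iwahori `I'_{1,K}`, the element
`β_K ∈ K ∩ {β, β'}`, and the integers `n_K, m_K, t_K`. -/
structure Chamber (S : Setting) where
  K : Subgroup S.GG
  KoneS : Set S.GG
  IK : Set S.GG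
  I1 : Set S.GG
  I1' : Set S.GG
  βK : S.GG
  nK : ℤ
  mK : ℤ
  tK : ℕ
  cases :
    ((K : Set S.GG) = S.K0set ∧ KoneS = S.Kone0 ∧ IK = S.IK0 ∧ I1 = S.I1K0 ∧ I1' = S.I1'K0 ∧
      βK = S.betaE ∧ nK = 0 ∧ mK = 1 ∧ tK = 3) ∨
    ((K : Set S.GG) = S.K1set ∧ KoneS = S.Kone1 ∧ IK = S.IK1 ∧ I1 = S.I1K1 ∧ I1' = S.I1'K1 ∧
      βK = S.betaPr ∧ nK = -1 ∧ mK = 2 ∧ tK = 1)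

namespace Chamber

variable {S : Setting} (C : Chamber S)

/-- `H₀ = H ∩ I_K`. -/
def H0 : Set S.GG := S.Hset ∩ C.IK

/-- `H₁ = H ∩ I_{1,K}`. -/
def H1 : Set S.GG := S.Hset ∩ C.I1

end Chamber

section RepTheory

variable {S : Setting} (C : Chamber S)
variable (𝔽 : Type) [Field 𝔽]

section Generic

variable {G₀ : Type} [Monoid G₀] {V : Type} [AddCommGroup V] [Module 𝔽 V]

/-- A submodule is invariant under a representation. -/
def Invt (ρ : Representation 𝔽 G₀ V) (Ssub : Submodule 𝔽 V) : Prop :=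
  ∀ g v, v ∈ Ssub → ρ g v ∈ Ssub

/-- The subrepresentation generated by a vector (the span of its orbit). -/
def orbitSpan (ρ : Representation 𝔽 G₀ V) (v : V) : Submodule 𝔽 V :=
  Submodule.span 𝔽 {w | ∃ g, w = ρ g v}

/-- The subrepresentation generated by a vector under a subset `A` of the group. -/
def orbitSpanOn (ρ : Representation 𝔽 G₀ V) (A : Set G₀) (v : V) : Submodule 𝔽 V :=
  Submodule.span 𝔽 {w | ∃ g ∈ A, w = ρ g v}

/-- The quotient of a representation by an invariant submodule `N` is irreducible:
equivalently (by the lattice correspondence), `N ≠ ⊤` and any invariant submodule lying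
between `N` and `⊤` equals `N` or `⊤`. -/
def QuotientIrreducible (ρ : Representation 𝔽 G₀ V) (N : Submodule 𝔽 V) : Prop :=
  N ≠ ⊤ ∧ ∀ Ssub : Submodule 𝔽 V, Invt 𝔽 ρ Ssub → N ≤ Ssub → Ssub = N ∨ Ssub = ⊤

/-- The submodule of vectors invariant under all elements of the subset `A`. -/
def invariantsOn (ρ : Representation 𝔽 G₀ V) (A : Set G₀) : Submodule 𝔽 V where
  carrier := {v | ∀ g ∈ A, ρ g v = v}
  add_mem' := by
    intro a b ha hb g hg
    rw [map_add, ha g hg, hb g hg]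
  zero_mem' := by
    intro g hg
    rw [map_zero]
  smul_mem' := by
    intro c a ha g hg
    rw [map_smul, ha g hg]

/-- The space `Hom_G(ρ₁, ρ₂)` of equivariant linear maps, as a submodule of the linear maps. -/
def EquivHomSub {V₂ : Type} [AddCommGroup V₂] [Module 𝔽 V₂]
    (ρ₁ : Representation 𝔽 G₀ V) (ρ₂ : Representation 𝔽 G₀ V₂) :
    Submodule 𝔽 (V →ₗ[𝔽] V₂) where
  carrier := {φ | ∀ g x, φ (ρ₁ g x) = ρ₂ g (φ x)}
  add_mem' := by
    intro a b ha hb g x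
    simp only [LinearMap.add_apply, ha g x, hb g x, map_add]
  zero_mem' := by
    intro g x
    simp only [LinearMap.zero_apply, map_zero]
  smul_mem' := by
    intro c a ha g x
    simp only [LinearMap.smul_apply, ha g x, map_smul]

end Generic

section Weight

variable (W : Type) [AddCommGroup W] [Module 𝔽 W]
variable (σ : Representation 𝔽 ↥C.K W)

/-- Extension of `σ` to all of `G` (by `1` outside `K`); used to avoid coercion issues. -/
def sigma' : S.GG → Module.End 𝔽 W := fun g => if h : g ∈ C.K then σ ⟨g, h⟩ else 1

/-- `σ` is a weight of `K`: an irreducible smooth representation of `K` over `𝔽`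
factoring through `Γ_K = K / K¹` (automatically finite dimensional). -/
def IsWeight : Prop :=
  Nontrivial W ∧ FiniteDimensional 𝔽 W ∧
  (∀ Ssub : Submodule 𝔽 W, (∀ (k : ↥C.K) (w : W), w ∈ Ssub → σ k w ∈ Ssub) → Ssub = ⊥ ∨ Ssub = ⊤) ∧
  (∀ (g : S.GG) (hg : g ∈ C.K), g ∈ C.KoneS → σ ⟨g, hg⟩ = LinearMap.id)

/-- `σ` is one dimensional of the form `χ ∘ det`. -/
def IsDetWeight : Prop :=
  Module.finrank 𝔽 W = 1 ∧
  ∃ c : S.E → 𝔽, ∀ (g : S.GG) (hg : g ∈ C.K) (w : W), σ ⟨g, hg⟩ w = c ((S.mat g).det) • w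

/-- `j_σ : σ → σ` is the composition of the coinvariant projection `σ → σ_{I'_{1,K}}`
with the inverse of the natural isomorphism `σ^{I_{1,K}} ≅ σ_{I'_{1,K}}`:
it restricts to the identity on `σ^{I_{1,K}}` and kills the augmentation part of
`σ` with respect to `I'_{1,K}`. -/
def IsJ (jσ : W →ₗ[𝔽] W) : Prop :=
  (∀ w : W, (∀ g ∈ C.I1, sigma' C 𝔽 W σ g w = w) → jσ w = w) ∧
  (∀ (w : W) (g : S.GG), g ∈ C.I1' → jσ (sigma' C 𝔽 W σ g w - w) = 0)

/-- The defining conditions of the compact induction `ind_K^G σ`: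
`K`-equivariance on the left and compact support (finitely many cosets `K g`). -/
def IndCarrier : Set (S.GG → W) :=
  {f | (∀ (k : S.GG) (hk : k ∈ C.K) (g : S.GG), f (k * g) = σ ⟨k, hk⟩ (f g)) ∧
       ∃ s : Finset S.GG, ∀ g : S.GG, f g ≠ 0 → ∃ k ∈ C.K, ∃ t ∈ s, g = k * t}

/-- The compact induction `ind_K^G σ`, as a submodule of `G → W`. -/
def IndSub : Submodule 𝔽 (S.GG → W) where
  carrier := IndCarrier C 𝔽 W σ
  add_mem' := by
    rintro f g ⟨hf1, sf, hf2⟩ ⟨hg1, sg, hg2⟩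
    refine ⟨fun k hk x => by simp [hf1 k hk x, hg1 k hk x], sf ∪ sg, fun x hx => ?_⟩
    by_cases h : f x ≠ 0
    · obtain ⟨k, hk, t, ht, rfl⟩ := hf2 x h
      exact ⟨k, hk, t, Finset.mem_union_left _ ht, rfl⟩
    · push_neg at h
      have hgx : g x ≠ 0 := by
        intro h0
        apply hx
        simp [Pi.add_apply, h, h0]
      obtain ⟨k, hk, t, ht, rfl⟩ := hg2 x hgx
      exact ⟨k, hk, t, Finset.mem_union_right _ ht, rfl⟩
  zero_mem' := ⟨fun k hk g => by simp, ∅, fun g hg => absurd rfl hg⟩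
  smul_mem' := by
    rintro c f ⟨hf1, sf, hf2⟩
    refine ⟨fun k hk g => by simp [hf1 k hk g], sf, fun x hx => ?_⟩
    refine hf2 x ?_
    intro h0
    apply hx
    simp [h0]

lemma indAct_mem (g : S.GG) {f : S.GG → W} (hf : f ∈ IndCarrier C 𝔽 W σ) :
    (fun x => f (x * g)) ∈ IndCarrier C 𝔽 W σ := by
  obtain ⟨h1, s, h2⟩ := hf
  refine ⟨fun k hk x => ?_, s.image (· * g⁻¹), ?_⟩
  · show f (k * x * g) = _
    rw [mul_assoc]
    exact h1 k hk (x * g)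
  intro x hx
  obtain ⟨k, hk, t, ht, hxg⟩ := h2 (x * g) hx
  refine ⟨k, hk, t * g⁻¹, Finset.mem_image_of_mem _ ht, ?_⟩
  rw [← mul_assoc, ← hxg, mul_assoc, mul_inv_cancel, mul_one]

/-- The representation of `G` on `ind_K^G σ` by right translation. -/
def indRep : Representation 𝔽 S.GG ↥(IndSub C 𝔽 W σ) where
  toFun g :=
    { toFun := fun f => ⟨fun x => (f : S.GG → W) (x * g), indAct_mem C 𝔽 W σ g f.2⟩
      map_add' := fun f1 f2 => Subtype.ext (funext fun x => rfl)
      map_smul' := fun c f => Subtype.ext (funext fun x => rfl) }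
  map_one' := LinearMap.ext fun f => Subtype.ext (funext fun x => by simp [mul_one])
  map_mul' g h := LinearMap.ext fun f => Subtype.ext (funext fun x => by simp [mul_assoc])

/-- The function `[g, v] ∈ ind_K^G σ`: supported on `K g⁻¹`, with value `v` at `g⁻¹`. -/
def stdFn (g : S.GG) (v : W) : S.GG → W :=
  fun x => if h : x * g ∈ C.K then σ ⟨x * g, h⟩ v else 0

/-- The characterization of the family `f_n` (`n ∈ ℤ`) of `I_{1,K}`-invariant elements of
`ind_K^G σ`: `f_n` is supported on `K α⁻ⁿ I_{1,K}` and has value at `α⁻ⁿ` equal to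
`σ(β_K) v₀` for `n > 0` and `v₀` for `n ≤ 0`, where `v₀` is a fixed nonzero vector of
`σ^{I_{1,K}}`. -/
def IsFFamily (v0 : W) (ff : ℤ → ↥(IndSub C 𝔽 W σ)) : Prop :=
  v0 ≠ 0 ∧ (∀ g ∈ C.I1, sigma' C 𝔽 W σ g v0 = v0) ∧
  (∀ (n : ℤ) (g : S.GG), g ∈ C.I1 → indRep C 𝔽 W σ g (ff n) = ff n) ∧
  (∀ (n : ℤ) (x : S.GG), (ff n : S.GG → W) x ≠ 0 →
    ∃ k ∈ C.K, ∃ i ∈ C.I1, x = k * S.alphaE ^ (-n) * i) ∧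
  (∀ n : ℤ, 0 < n → (ff n : S.GG → W) (S.alphaE ^ (-n)) = sigma' C 𝔽 W σ C.βK v0) ∧
  (∀ n : ℤ, n ≤ 0 → (ff n : S.GG → W) (S.alphaE ^ (-n)) = v0)

/-- The characterization of the Hecke operator `T ∈ End_G(ind_K^G σ)`:
it is `G`-equivariant and satisfies
`T [1, v] = ∑_{u ∈ N_{n_K}/N_{n_K+2}} [u α⁻¹, j_σ σ(u⁻¹) v]
  + ∑_{u ∈ N_{n_K+1}/N_{n_K+2}} [β_K u α⁻¹, j_σ σ(β_K) v]`. -/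
def IsHeckeT (jσ : W →ₗ[𝔽] W) (T : Module.End 𝔽 ↥(IndSub C 𝔽 W σ)) : Prop :=
  (∀ (g : S.GG) (x : ↥(IndSub C 𝔽 W σ)),
    T (indRep C 𝔽 W σ g x) = indRep C 𝔽 W σ g (T x)) ∧
  (∀ (v : W) (x : ↥(IndSub C 𝔽 W σ)), (x : S.GG → W) = stdFn C 𝔽 W σ 1 v →
    ∀ (U2 U1 : Finset S.GG),
      S.IsReps (S.Nk C.nK) (S.Nk (C.nK + 2)) U2 →
      S.IsReps (S.Nk (C.nK + 1)) (S.Nk (C.nK + 2)) U1 →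
      ((T x : S.GG → W)) =
        (∑ u ∈ U2, stdFn C 𝔽 W σ (u * S.alphaE⁻¹) (jσ (sigma' C 𝔽 W σ u⁻¹ v))) +
        ∑ u ∈ U1, stdFn C 𝔽 W σ (C.βK * u * S.alphaE⁻¹) (jσ (sigma' C 𝔽 W σ C.βK v)))

/-- The eigencharacter `χ_σ` of `H₀/H₁` afforded by the (one-dimensional) space
`σ^{I_{1,K}}` with chosen basis vector `v₀`. -/
def IsChi (v0 : W) (χ : S.GG → 𝔽) : Prop :=
  (∀ h ∈ C.H0, sigma' C 𝔽 W σ h v0 = χ h • v0)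

/-- Right translation on functions `K → 𝔽` (the action on a (finite) principal series). -/
def PSact (k : ↥C.K) (f : ↥C.K → 𝔽) : ↥C.K → 𝔽 := fun x => f (x * k)

/-- The (inflation to `K` of the) finite principal series `Ind_𝔹^{Γ_K} χ`:
functions on `K`, invariant under right translation by `K¹`, left `I_{1,K}`-invariant and
left `(H₀, χ)`-equivariant. -/
def PSchiSub (χ : S.GG → 𝔽) : Submodule 𝔽 (↥C.K → 𝔽) where
  carrier := {f | (∀ b : ↥C.K, (b : S.GG) ∈ C.I1 → ∀ x, f (b * x) = f x) ∧
                  (∀ h : ↥C.K, (h : S.GG) ∈ C.H0 → ∀ x, f (h * x) = χ (h : S.GG) * f x) ∧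
                  (∀ z : ↥C.K, (z : S.GG) ∈ C.KoneS → ∀ x, f (x * z) = f x)}
  add_mem' := by
    rintro f g ⟨hf1, hf2, hf3⟩ ⟨hg1, hg2, hg3⟩
    exact ⟨fun b hb x => by simp [hf1 b hb x, hg1 b hb x],
           fun h hh x => by simp [hf2 h hh x, hg2 h hh x, mul_add],
           fun z hz x => by simp [hf3 z hz x, hg3 z hz x]⟩
  zero_mem' := ⟨fun b hb x => rfl, fun h hh x => by simp, fun z hz x => rfl⟩
  smul_mem' := by
    rintro c f ⟨hf1, hf2, hf3⟩
    refine ⟨fun b hb x => by simp [hf1 b hb x], fun h hh x => ?_, fun z hz x => by simp [hf3 z hz x]⟩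
    simp only [Pi.smul_apply, hf2 h hh x, smul_eq_mul]
    ring

/-- The principal series `Ind_𝔹^{Γ_K} 1` for the trivial character. -/
def PS1sub : Submodule 𝔽 (↥C.K → 𝔽) := PSchiSub C 𝔽 (fun _ => 1)

/-- `σ_{st}` is the Steinberg weight `st = (Ind_𝔹^{Γ_K} 1)/1`: there is a surjective
`K`-equivariant linear map from `Ind_𝔹^{Γ_K} 1` to it whose kernel is exactly the
constant functions. -/
def IsSteinberg {Wst : Type} [AddCommGroup Wst] [Module 𝔽 Wst]
    (σst : Representation 𝔽 ↥C.K Wst) : Prop :=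
  ∃ φ : ↥(PS1sub C 𝔽) →ₗ[𝔽] Wst, Function.Surjective φ ∧
    (∀ f : ↥(PS1sub C 𝔽), φ f = 0 ↔ ∃ c : 𝔽, (f : ↥C.K → 𝔽) = fun _ => c) ∧
    (∀ (k : ↥C.K) (f f' : ↥(PS1sub C 𝔽)),
      (f' : ↥C.K → 𝔽) = PSact C 𝔽 k (f : ↥C.K → 𝔽) → φ f' = σst k (φ f))

/-- `σ` is isomorphic to a twist of the Steinberg weight by a character. -/
def IsTwistSteinberg : Prop :=
  ∃ (c : ↥C.K →* 𝔽ˣ) (φ : ↥(PS1sub C 𝔽) →ₗ[𝔽] W), Function.Surjective φ ∧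
    (∀ f : ↥(PS1sub C 𝔽), φ f = 0 ↔ ∃ cc : 𝔽, (f : ↥C.K → 𝔽) = fun _ => cc) ∧
    (∀ (k : ↥C.K) (f f' : ↥(PS1sub C 𝔽)),
      (f' : ↥C.K → 𝔽) = PSact C 𝔽 k (f : ↥C.K → 𝔽) →
        φ f' = (c k : 𝔽) • σ k (φ f))


/-- The `K`-subrepresentation of the quotient `(ind_K^G σ) / (range T)` generated by the
image of a vector `v`. -/
def genQuot (T : Module.End 𝔽 ↥(IndSub C 𝔽 W σ)) (v : ↥(IndSub C 𝔽 W σ)) :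
    Submodule 𝔽 (↥(IndSub C 𝔽 W σ) ⧸ LinearMap.range T) :=
  Submodule.span 𝔽 {w | ∃ k ∈ C.K, w = Submodule.Quotient.mk (indRep C 𝔽 W σ k v)}

end Weight

/-- Smoothness of a representation of `G`: every vector is fixed by some congruence
subgroup (equivalently, has open stabilizer). -/
def SmoothRep {V : Type} [AddCommGroup V] [Module 𝔽 V] (ρ : Representation 𝔽 S.GG V) : Prop :=
  ∀ v : V, ∃ n : ℕ, ∀ g ∈ S.cong n, ρ g v = v

end RepTheory

end U21

namespace U21

namespace Setting
variable (S : Setting)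

/-- The elements of `E` whose valuation is at least `k / 2`. -/
def halfD (k : ℤ) : AddSubgroup S.E where
  carrier := {x | ∃ m : ℤ, k ≤ 2 * m ∧ x ∈ S.pE m}
  zero_mem' := ⟨|k|, by cases abs_cases k <;> omega, 0, S.O.zero_mem, by simp⟩
  add_mem' := by
    have key : ∀ m n : ℤ, m ≤ n → ∀ v ∈ S.O, ∀ w ∈ S.O,
        S.ϖ ^ m * v + S.ϖ ^ n * w ∈ S.pE m := by
      intro m n hmn v hv w hw
      obtain ⟨j, rfl⟩ := Int.le.dest hmn
      refine ⟨v + S.ϖ ^ j * w, S.O.add_mem hv (S.O.mul_mem (S.O.pow_mem S.unif_mem j) hw), ?_⟩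
      rw [zpow_add₀ S.unif_ne, zpow_natCast]
      ring
    rintro _ _ ⟨m, hm, v, hv, rfl⟩ ⟨n, hn, w, hw, rfl⟩
    rcases le_total m n with h | h
    · exact ⟨m, hm, key m n h v hv w hw⟩
    · exact ⟨n, hn, by rw [add_comm]; exact key n m h w hw v hv⟩
  neg_mem' := by
    rintro _ ⟨m, hm, v, hv, rfl⟩
    exact ⟨m, hm, -v, S.O.neg_mem hv, by ring⟩

variable {S}

lemma halfD_mono {k l : ℤ} (h : l ≤ k) {x : S.E} (hx : x ∈ S.halfD k) : x ∈ S.halfD l := by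
  obtain ⟨m, hm, hx⟩ := hx
  exact ⟨m, h.trans hm, hx⟩

lemma mul_mem_halfD {k l n : ℤ} {x y : S.E} (hx : x ∈ S.halfD k) (hy : y ∈ S.halfD l)
    (h : n ≤ k + l) : x * y ∈ S.halfD n := by
  obtain ⟨a, ha, v, hv, rfl⟩ := hx
  obtain ⟨b, hb, w, hw, rfl⟩ := hy
  refine ⟨a + b, by omega, v * w, S.O.mul_mem hv hw, ?_⟩
  rw [zpow_add₀ S.unif_ne]
  ring

lemma conj_mem_halfD {k : ℤ} {x : S.E} (hx : x ∈ S.halfD k) : S.conj x ∈ S.halfD k := by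
  obtain ⟨a, ha, v, hv, rfl⟩ := hx
  exact ⟨a, ha, S.conj v, S.conj_O v hv, by rw [map_mul, map_zpow₀, S.unif_conj]⟩

lemma unif_zpow_mem_halfD {k n : ℤ} (h : k ≤ 2 * n) : S.ϖ ^ n ∈ S.halfD k :=
  ⟨n, h, 1, S.O.one_mem, by simp⟩

lemma one_mem_halfD {k : ℤ} (h : k ≤ 0) : (1 : S.E) ∈ S.halfD k :=
  ⟨0, by omega, 1, S.O.one_mem, by simp⟩

lemma mem_pE_iff {m k : ℤ} (h₁ : k ≤ 2 * m) (h₂ : 2 * m ≤ k + 1) {x : S.E} :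
    x ∈ S.pE m ↔ x ∈ S.halfD k := by
  refine ⟨fun h => ⟨m, h₁, h⟩, ?_⟩
  rintro ⟨n, hn, v, hv, rfl⟩
  obtain ⟨j, rfl⟩ := Int.le.dest (show m ≤ n by omega)
  refine ⟨S.ϖ ^ j * v, S.O.mul_mem (S.O.pow_mem S.unif_mem j) hv, ?_⟩
  rw [zpow_add₀ S.unif_ne, zpow_natCast]
  ring

lemma mem_O_iff {k : ℤ} (h₁ : k ≤ 0) (h₂ : 0 ≤ k + 1) {x : S.E} : x ∈ S.O ↔ x ∈ S.halfD k := by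
  rw [← mem_pE_iff (m := 0) (by omega) (by omega)]
  exact ⟨fun h => ⟨x, h, by simp⟩, by rintro ⟨w, hw, rfl⟩; simpa using hw⟩

lemma one_notMem_halfD_one : (1 : S.E) ∉ S.halfD 1 := by
  rw [← mem_pE_iff (m := 1) (by omega) (by omega)]
  rintro ⟨w, hw, h⟩
  rw [zpow_one] at h
  exact S.unif_not_unit (IsUnit.of_mul_eq_one ⟨w, hw⟩ (Subtype.ext h.symm))

lemma inv_mem_halfD {k l : ℤ} {x : S.E} (hx : x ∉ S.halfD k) (h : l + k ≤ 1) :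
    x ≠ 0 ∧ x⁻¹ ∈ S.halfD l := by
  have hx0 : x ≠ 0 := by
    rintro rfl
    exact hx (zero_mem _)
  refine ⟨hx0, ?_⟩
  obtain ⟨n, u, hu⟩ := S.disc x hx0
  have hn : ¬ k ≤ 2 * n := fun hn => hx ⟨n, hn, (u : S.O), (u : S.O).2, by rw [hu]; ring⟩
  refine ⟨-n, by omega, ((u⁻¹ : S.Oˣ) : S.O), ((u⁻¹ : S.Oˣ) : S.O).2, ?_⟩
  have h1 : (((u : S.O)) : S.E) * (((u⁻¹ : S.Oˣ) : S.O) : S.E) = 1 := by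
    exact_mod_cast congrArg Subtype.val u.mul_inv
  rw [hu, mul_inv, zpow_neg, inv_eq_of_mul_eq_one_right h1]
  ring

lemma mem_halfD_of_norm {k l : ℤ} {x : S.E} (hl : 2 * k ≤ l + 1)
    (hx : x * S.conj x ∈ S.halfD l) : x ∈ S.halfD k := by
  by_contra h
  obtain ⟨h0, hi⟩ := inv_mem_halfD (l := 1 - k) h (by omega)
  apply one_notMem_halfD_one (S := S)
  have h0' : S.conj x ≠ 0 := (map_ne_zero _).2 h0
  have := mul_mem_halfD (n := 1) hx
    (mul_mem_halfD hi (conj_mem_halfD hi) le_rfl) (by omega)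
  rwa [map_inv₀, ← mul_inv, mul_inv_cancel₀ (mul_ne_zero h0 h0')] at this

end Setting

namespace Setting
variable {S : Setting}

lemma mat_injective : Function.Injective S.mat :=
  fun _ _ h => Subtype.ext (Units.ext h)

lemma mat_mul (g h : S.GG) : S.mat (g * h) = S.mat g * S.mat h := rfl

lemma mat_one : S.mat 1 = 1 := rfl

lemma mat_mul_apply (g h : S.GG) (i j : Fin 3) : S.mat (g * h) i j =
    S.mat g i 0 * S.mat h 0 j + S.mat g i 1 * S.mat h 1 j + S.mat g i 2 * S.mat h 2 j := by
  rw [mat_mul, Matrix.mul_apply, Fin.sum_univ_three]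

lemma mat_col (g : S.GG) (i j : Fin 3) :
    S.mat g 0 i * S.conj (S.mat g 2 j) + S.mat g 1 i * S.conj (S.mat g 1 j)
      + S.mat g 2 i * S.conj (S.mat g 0 j) = S.betaM i j := by
  have h : (S.mat g).transpose * S.betaM * ((S.mat g).map S.conj) = S.betaM := g.2
  rw [← h]
  simp [betaM, Matrix.mul_apply, Fin.sum_univ_three]
  ring

/-- The inverse of a matrix in the unitary group. -/
def adjM (M : S.M3) : S.M3 := Matrix.of fun i j => S.conj (M j.rev i.rev)

lemma mat_inv (g : S.GG) : S.mat g⁻¹ = adjM (S.mat g) := by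
  have h : adjM (S.mat g) * S.mat g = 1 := by
    ext i j
    have := mat_col g j i.rev
    rw [Matrix.mul_apply, Fin.sum_univ_three]
    simp only [adjM, Matrix.of_apply]
    fin_cases i <;> fin_cases j <;> simp [betaM] at this ⊢ <;> rw [← this] <;> ring
  have h' : S.mat g * S.mat g⁻¹ = 1 := by rw [← mat_mul, mul_inv_cancel, mat_one]
  calc S.mat g⁻¹ = adjM (S.mat g) * S.mat g * S.mat g⁻¹ := by rw [h, one_mul]
    _ = _ := by rw [mul_assoc, h', mul_one]

lemma mat_row (g : S.GG) (i j : Fin 3) :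
    S.mat g i 0 * S.conj (S.mat g j 2) + S.mat g i 1 * S.conj (S.mat g j 1)
      + S.mat g i 2 * S.conj (S.mat g j 0) = S.betaM i j := by
  have h : S.mat (g * g⁻¹) i j.rev = (1 : S.M3) i j.rev := by rw [mul_inv_cancel, mat_one]
  rw [mat_mul_apply, mat_inv] at h
  simp only [adjM, Matrix.of_apply, Fin.rev_rev] at h
  rw [show S.betaM i j = (1 : S.M3) i j.rev by
    fin_cases i <;> fin_cases j <;> simp [betaM, Fin.rev, Matrix.one_apply]]
  exact h

/-- The element of the unitary group with a given matrix. -/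
def ofMat (M : S.M3) (h : M.transpose * S.betaM * M.map S.conj = S.betaM) : S.GG :=
  ⟨Matrix.GeneralLinearGroup.mkOfDetNeZero M (by
    intro h0
    have h1 := congrArg Matrix.det h
    have h2 := congrArg Matrix.det S.beta_mul_beta
    rw [Matrix.det_mul, Matrix.det_mul, Matrix.det_transpose, h0] at h1
    rw [Matrix.det_mul, ← h1] at h2
    simp at h2), h⟩

lemma mat_ofMat (M : S.M3) (h) : S.mat (ofMat M h) = M := rfl

lemma n'M_mem {x y : S.E} (h : x * S.conj x + y + S.conj y = 0) :
    (S.n'M x y).transpose * S.betaM * (S.n'M x y).map S.conj = S.betaM := by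
  have h' : y + x * S.conj x + S.conj y = 0 := by rw [← h]; ring
  ext i j
  fin_cases i <;> fin_cases j <;>
    simp [n'M, betaM, Matrix.mul_apply, Fin.sum_univ_three, S.conj_invol, h']

lemma nM_mem {x y : S.E} (h : x * S.conj x + y + S.conj y = 0) :
    (S.nM x y).transpose * S.betaM * (S.nM x y).map S.conj = S.betaM := by
  have h' : S.conj y + S.conj x * x + y = 0 := by rw [← h]; ring
  ext i j
  fin_cases i <;> fin_cases j <;>
    simp [nM, betaM, Matrix.mul_apply, Fin.sum_univ_three, S.conj_invol, h']

variable (S) in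
/-- The lower unipotent subgroup of `G`. -/
def lowU : Subgroup S.GG where
  carrier := S.N'set
  one_mem' := ⟨0, 0, by simp, by ext i j; fin_cases i <;> fin_cases j <;> simp [mat_one, n'M]⟩
  mul_mem' := by
    rintro a b ⟨x, y, h, ha⟩ ⟨x', y', h', hb⟩
    refine ⟨x + x', y + y' - S.conj x * x', ?_, ?_⟩
    · simp only [map_add, map_sub, map_mul, S.conj_invol]
      linear_combination h + h'
    · rw [mat_mul, ha, hb]
      ext i j
      fin_cases i <;> fin_cases j <;> simp [n'M, Matrix.mul_apply, Fin.sum_univ_three] <;> ring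
  inv_mem' := by
    rintro a ⟨x, y, h, ha⟩
    refine ⟨-x, S.conj y, ?_, ?_⟩
    · simp only [map_neg, S.conj_invol]
      linear_combination h
    · rw [mat_inv, ha]
      ext i j
      fin_cases i <;> fin_cases j <;> simp [n'M, adjM, Fin.rev, S.conj_invol]

lemma gauss (g : S.GG) (hg : S.mat g 0 0 ≠ 0) :
    ∃ u h n : S.GG, g = u * h * n ∧
      (∃ x y, x * S.conj x + y + S.conj y = 0 ∧ S.mat u = S.n'M x y ∧
        x = S.mat g 1 0 * (S.mat g 0 0)⁻¹ ∧ y = S.mat g 2 0 * (S.mat g 0 0)⁻¹) ∧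
      (∃ x y, x * S.conj x + y + S.conj y = 0 ∧ S.mat n = S.nM x y ∧
        x = S.mat g 0 1 * (S.mat g 0 0)⁻¹ ∧ y = S.mat g 0 2 * (S.mat g 0 0)⁻¹) ∧
      (∃ e, e * S.conj e = 1 ∧
        S.mat h = !![S.mat g 0 0, 0, 0; 0, e, 0; 0, 0, (S.conj (S.mat g 0 0))⁻¹]) := by
  set a := S.mat g 0 0 with ha
  have hca : S.conj a ≠ 0 := (map_ne_zero _).2 hg
  have hcol : ∃ x y, x * S.conj x + y + S.conj y = 0 ∧ S.mat g 1 0 = a * x ∧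
      S.mat g 2 0 = a * y ∧ x = S.mat g 1 0 * a⁻¹ ∧ y = S.mat g 2 0 * a⁻¹ := by
    refine ⟨S.mat g 1 0 * a⁻¹, S.mat g 2 0 * a⁻¹, ?_, by field_simp, by field_simp, rfl, rfl⟩
    have := mat_col g 0 0
    simp [betaM, ← ha] at this
    simp only [map_mul, map_inv₀]
    field_simp
    linear_combination this
  have hrow : ∃ x y, x * S.conj x + y + S.conj y = 0 ∧ S.mat g 0 1 = a * x ∧
      S.mat g 0 2 = a * y ∧ x = S.mat g 0 1 * a⁻¹ ∧ y = S.mat g 0 2 * a⁻¹ := by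
    refine ⟨S.mat g 0 1 * a⁻¹, S.mat g 0 2 * a⁻¹, ?_, by field_simp, by field_simp, rfl, rfl⟩
    have := mat_row g 0 0
    simp [betaM, ← ha] at this
    simp only [map_mul, map_inv₀]
    field_simp
    linear_combination this
  obtain ⟨x, y, hxy, hx, hy, hx', hy'⟩ := hcol
  obtain ⟨z, w, hzw, hz, hw, hz', hw'⟩ := hrow
  set u := ofMat _ (n'M_mem hxy) with hu
  set n := ofMat _ (nM_mem hzw) with hn
  set h := u⁻¹ * g * n⁻¹ with hh
  have e00 : S.mat h 0 0 = a := by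
    simp only [hh, mat_mul_apply, mat_inv, hu, hn, mat_ofMat, adjM, n'M, nM, Matrix.of_apply]
    simp [Fin.rev, ← ha]
  have e10 : S.mat h 1 0 = 0 := by
    simp only [hh, mat_mul_apply, mat_inv, hu, hn, mat_ofMat, adjM, n'M, nM, Matrix.of_apply]
    simp [Fin.rev, ← ha, hx, S.conj_invol]
    ring
  have e20 : S.mat h 2 0 = 0 := by
    simp only [hh, mat_mul_apply, mat_inv, hu, hn, mat_ofMat, adjM, n'M, nM, Matrix.of_apply]
    simp [Fin.rev, ← ha, hx, hy]
    linear_combination a * hxy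
  have e01 : S.mat h 0 1 = 0 := by
    simp only [hh, mat_mul_apply, mat_inv, hu, hn, mat_ofMat, adjM, n'M, nM, Matrix.of_apply]
    simp [Fin.rev, ← ha, hz, S.conj_invol]
  have e02 : S.mat h 0 2 = 0 := by
    simp only [hh, mat_mul_apply, mat_inv, hu, hn, mat_ofMat, adjM, n'M, nM, Matrix.of_apply]
    simp [Fin.rev, ← ha, hz, hw]
    linear_combination a * hzw
  have e21 : S.mat h 2 1 = 0 := by
    have := mat_col h 0 1
    simpa [betaM, e00, e10, e20, e01, hg] using this
  have e11 : S.mat h 1 1 * S.conj (S.mat h 1 1) = 1 := by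
    have := mat_col h 1 1
    simpa [betaM, e01, e21] using this
  have e12 : S.mat h 1 2 = 0 := by
    have := mat_col h 1 2
    have h0 : S.mat h 1 1 ≠ 0 := left_ne_zero_of_mul (by rw [e11]; exact one_ne_zero)
    simpa [betaM, e01, e21, h0] using this
  have e22 : S.mat h 2 2 = (S.conj a)⁻¹ := by
    have := mat_col h 2 0
    simp [betaM, e00, e10, e20, e02, e12] at this
    exact eq_inv_of_mul_eq_one_left this
  refine ⟨u, h, n, by rw [hh]; group, ⟨x, y, hxy, rfl, hx', hy'⟩, ⟨z, w, hzw, rfl, hz', hw'⟩,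
    S.mat h 1 1, e11, ?_⟩
  ext i j
  fin_cases i <;> fin_cases j <;> simp [e00, e01, e02, e10, e12, e20, e21, e22]

end Setting

namespace Setting
variable {S : Setting}

variable (S) in
/-- The matrices whose `(i, j)` entry has valuation at least `(m + d * (i - j)) / 2`. -/
def matLevel (d m : ℤ) (M : S.M3) : Prop :=
  ∀ i j : Fin 3, M i j ∈ S.halfD (m + d * (((i : ℕ) : ℤ) - ((j : ℕ) : ℤ)))

lemma matLevel_iff {d m : ℤ} {M : S.M3} : S.matLevel d m M ↔
    (M 0 0 ∈ S.halfD m ∧ M 0 1 ∈ S.halfD (m - d) ∧ M 0 2 ∈ S.halfD (m - 2 * d)) ∧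
    (M 1 0 ∈ S.halfD (m + d) ∧ M 1 1 ∈ S.halfD m ∧ M 1 2 ∈ S.halfD (m - d)) ∧
    (M 2 0 ∈ S.halfD (m + 2 * d) ∧ M 2 1 ∈ S.halfD (m + d) ∧ M 2 2 ∈ S.halfD m) := by
  constructor
  · intro h
    exact ⟨⟨halfD_mono (by simp) (h 0 0), halfD_mono (by simp) (h 0 1),
      halfD_mono (by simp; omega) (h 0 2)⟩, ⟨halfD_mono (by simp) (h 1 0),
      halfD_mono (by simp) (h 1 1), halfD_mono (by simp) (h 1 2)⟩,
      halfD_mono (by simp; omega) (h 2 0), halfD_mono (by simp) (h 2 1),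
      halfD_mono (by simp) (h 2 2)⟩
  · rintro ⟨⟨h00, h01, h02⟩, ⟨h10, h11, h12⟩, h20, h21, h22⟩ i j
    fin_cases i <;> fin_cases j
    exacts [halfD_mono (by simp) h00, halfD_mono (by simp) h01,
      halfD_mono (by simp; omega) h02, halfD_mono (by simp) h10, halfD_mono (by simp) h11,
      halfD_mono (by simp) h12, halfD_mono (by simp; omega) h20,
      halfD_mono (by simp) h21, halfD_mono (by simp) h22]

lemma matLevel.mul {d m n : ℤ} {A B : S.M3} (hA : S.matLevel d m A) (hB : S.matLevel d n B) :
    S.matLevel d (m + n) (A * B) := by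
  intro i j
  rw [Matrix.mul_apply]
  exact sum_mem fun k _ => mul_mem_halfD (hA i k) (hB k j) (by ring_nf; rfl)

lemma matLevel.mono {d m n : ℤ} {A : S.M3} (hA : S.matLevel d m A) (h : n ≤ m) :
    S.matLevel d n A :=
  fun i j => halfD_mono (by omega) (hA i j)

/-- If the outer entries of a column have small product, so does the norm of the middle one. -/
lemma matLevel.middle_row {d m : ℤ} {g : S.GG} (hg : S.matLevel d m (S.mat g)) (j : Fin 3)
    (h0 : S.mat g 0 j ∈ S.halfD (m + 1 - d * ((j : ℕ) : ℤ)))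
    (hb : S.betaM j j ∈ S.halfD (2 * m + 1 + 2 * d - 2 * (d * ((j : ℕ) : ℤ)))) :
    S.mat g 1 j ∈ S.halfD (m + 1 + d - d * ((j : ℕ) : ℤ)) := by
  apply mem_halfD_of_norm (l := 2 * m + 1 + 2 * d - 2 * (d * ((j : ℕ) : ℤ))) (by omega)
  have h2 : S.mat g 2 j ∈ S.halfD (m + 2 * d - d * ((j : ℕ) : ℤ)) := by
    convert hg 2 j using 2
    simp
    ring
  have h := mat_col g j j
  have e : S.mat g 1 j * S.conj (S.mat g 1 j) = S.betaM j j
      - S.mat g 0 j * S.conj (S.mat g 2 j) - S.mat g 2 j * S.conj (S.mat g 0 j) := by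
    rw [← h]; ring
  rw [e]
  exact sub_mem (sub_mem hb (mul_mem_halfD h0 (conj_mem_halfD h2) (by omega)))
    (mul_mem_halfD h2 (conj_mem_halfD h0) (by omega))

lemma matLevel.middle_col {d m : ℤ} {g : S.GG} (hg : S.matLevel d m (S.mat g)) (i : Fin 3)
    (h0 : S.mat g i 0 ∈ S.halfD (m + 1 + d * ((i : ℕ) : ℤ)))
    (hb : S.betaM i i ∈ S.halfD (2 * m + 1 - 2 * d + 2 * (d * ((i : ℕ) : ℤ)))) :
    S.mat g i 1 ∈ S.halfD (m + 1 - d + d * ((i : ℕ) : ℤ)) := by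
  apply mem_halfD_of_norm (l := 2 * m + 1 - 2 * d + 2 * (d * ((i : ℕ) : ℤ))) (by omega)
  have h2 : S.mat g i 2 ∈ S.halfD (m - 2 * d + d * ((i : ℕ) : ℤ)) := by
    convert hg i 2 using 2
    simp
    ring
  have h := mat_row g i i
  have e : S.mat g i 1 * S.conj (S.mat g i 1) = S.betaM i i
      - S.mat g i 0 * S.conj (S.mat g i 2) - S.mat g i 2 * S.conj (S.mat g i 0) := by
    rw [← h]; ring
  rw [e]
  exact sub_mem (sub_mem hb (mul_mem_halfD h0 (conj_mem_halfD h2) (by omega)))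
    (mul_mem_halfD h2 (conj_mem_halfD h0) (by omega))

lemma exists_maximal_level (d : ℤ) (g : S.GG) :
    ∃ m : ℤ, S.matLevel d m (S.mat g) ∧ ¬ S.matLevel d (m + 1) (S.mat g) := by
  have hlow : ∃ m : ℤ, S.matLevel d m (S.mat g) := by
    have key : ∀ x : S.E, ∃ k : ℤ, x ∈ S.halfD k := by
      intro x
      by_cases hx : x = 0
      · exact ⟨0, hx ▸ zero_mem _⟩
      · obtain ⟨n, u, hu⟩ := S.disc x hx
        exact ⟨2 * n, n, le_rfl, (u : S.O), (u : S.O).2, by rw [hu]; ring⟩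
    choose k hk using key
    have hf : ∃ m : ℤ, ∀ ij : Fin 3 × Fin 3, m ≤ k (S.mat g ij.1 ij.2)
        - d * (((ij.1 : ℕ) : ℤ) - ((ij.2 : ℕ) : ℤ)) := by
      obtain ⟨m, hm⟩ := (Set.finite_range fun ij : Fin 3 × Fin 3 => k (S.mat g ij.1 ij.2)
        - d * (((ij.1 : ℕ) : ℤ) - ((ij.2 : ℕ) : ℤ))).bddBelow
      exact ⟨m, fun ij => hm ⟨ij, rfl⟩⟩
    obtain ⟨m, hm⟩ := hf
    exact ⟨m, fun i j => halfD_mono (by have := hm (i, j); simp only at this; omega) (hk _)⟩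
  have hup : ∃ b : ℤ, ∀ m : ℤ, S.matLevel d m (S.mat g) → m ≤ b := by
    obtain ⟨n, hn⟩ : ∃ n : ℤ, S.matLevel d n (S.mat g⁻¹) := by
      obtain ⟨m, hm⟩ := hlow
      refine ⟨m, fun i j => ?_⟩
      rw [mat_inv]
      simp only [adjM, Matrix.of_apply]
      convert conj_mem_halfD (hm j.rev i.rev) using 2
      fin_cases i <;> fin_cases j <;> simp [Fin.rev]
    refine ⟨-n, fun m hm => ?_⟩
    by_contra hlt
    have h1 := ((hm.mul hn).mono (n := 1) (by omega)) 0 0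
    rw [← mat_mul, mul_inv_cancel, mat_one] at h1
    exact one_notMem_halfD_one (by simpa using h1)
  obtain ⟨b, hb⟩ := hup
  obtain ⟨m, hm, hmax⟩ := Int.exists_greatest_of_bdd ⟨b, hb⟩ hlow
  exact ⟨m, hm, fun h => by have := hmax _ h; omega⟩

lemma exists_corner {d m : ℤ} (hm : m < 0) {g : S.GG} (hg : S.matLevel d m (S.mat g))
    (hg' : ¬ S.matLevel d (m + 1) (S.mat g)) :
    S.mat g 0 0 ∉ S.halfD (m + 1) ∨ S.mat g 0 2 ∉ S.halfD (m + 1 - 2 * d) ∨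
    S.mat g 2 0 ∉ S.halfD (m + 1 + 2 * d) ∨ S.mat g 2 2 ∉ S.halfD (m + 1) := by
  by_contra! h
  obtain ⟨h00, h02, h20, h22⟩ := h
  apply hg'
  have h10 := hg.middle_row 0 (by simpa using h00) (by simp [betaM])
  have h12 := hg.middle_row 2 (by convert h02 using 2; simp; ring) (by simp [betaM])
  have h01 := hg.middle_col 0 (by simpa using h00) (by simp [betaM])
  have h21 := hg.middle_col 2 (by convert h20 using 2; simp; ring) (by simp [betaM])
  have h11 := hg.middle_row 1 (by convert h01 using 2; simp)
    (by simp only [betaM]; apply one_mem_halfD; simp; omega)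
  refine matLevel_iff.2 ⟨⟨h00, ?_, h02⟩, ⟨?_, ?_, ?_⟩, h20, ?_, h22⟩
  · simpa using h01
  · simpa using h10
  · simpa using h11
  · convert h12 using 2; simp; ring
  · convert h21 using 2; simp; ring

variable (S) in
/-- The matrix of the Weyl element attached to `d`. -/
def weylM (d : ℤ) : S.M3 := !![0, 0, S.ϖ ^ (-d); 0, 1, 0; S.ϖ ^ d, 0, 0]

lemma matLevel_weylM (d : ℤ) : S.matLevel d 0 (S.weylM d) := by
  rw [matLevel_iff]
  simp only [weylM]
  refine ⟨⟨?_, ?_, ?_⟩, ⟨?_, ?_, ?_⟩, ?_, ?_, ?_⟩ <;>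
    first
    | exact zero_mem _
    | exact one_mem_halfD le_rfl
    | exact unif_zpow_mem_halfD (by omega)

lemma matLevel_n'M {d : ℤ} {x y : S.E} (hx : x ∈ S.halfD d) (hy : y ∈ S.halfD (2 * d)) :
    S.matLevel d 0 (S.n'M x y) := by
  rw [matLevel_iff]
  simp only [n'M, zero_add]
  exact ⟨⟨one_mem_halfD le_rfl, zero_mem _, zero_mem _⟩,
    ⟨hx, one_mem_halfD le_rfl, zero_mem _⟩, hy, neg_mem (conj_mem_halfD hx), one_mem_halfD le_rfl⟩

lemma matLevel_nM {d : ℤ} {x y : S.E} (hx : x ∈ S.halfD (-d)) (hy : y ∈ S.halfD (-(2 * d))) :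
    S.matLevel d 0 (S.nM x y) := by
  rw [matLevel_iff]
  simp only [nM, zero_sub]
  exact ⟨⟨one_mem_halfD le_rfl, hx, hy⟩, ⟨zero_mem _, one_mem_halfD le_rfl,
    neg_mem (conj_mem_halfD hx)⟩, zero_mem _, zero_mem _, one_mem_halfD le_rfl⟩

lemma matLevel_n'M_sub_one {d : ℤ} {x y : S.E} (hx : x ∈ S.halfD (1 + d))
    (hy : y ∈ S.halfD (1 + 2 * d)) : S.matLevel d 1 (S.n'M x y - 1) := by
  rw [matLevel_iff]
  simp [n'M, hx, hy, conj_mem_halfD, zero_mem]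

lemma matLevel_nM_sub_one {d : ℤ} {x y : S.E} (hx : x ∈ S.halfD (1 - d))
    (hy : y ∈ S.halfD (1 - 2 * d)) : S.matLevel d 1 (S.nM x y - 1) := by
  rw [matLevel_iff]
  simp [nM, hx, hy, conj_mem_halfD, zero_mem]

end Setting

namespace Chamber
open Setting
variable {S : Setting}

/-- `K` and the subgroups attached to it are described by the levels of matrices. -/
structure IsLevel (C : Chamber S) (d : ℤ) : Prop where
  mem_K : ∀ g, g ∈ C.K ↔ S.matLevel d 0 (S.mat g)
  mem_KoneS : ∀ g, S.matLevel d 1 (S.mat g - 1) → g ∈ C.KoneS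
  mem_H0 : ∀ g, g ∈ C.H0 ↔ g ∈ S.Hset ∧ g ∈ C.K
  mem_I1 : ∀ g ∈ C.K, ∀ x y, S.mat g = S.nM x y → g ∈ C.I1
  mat_βK : S.mat C.βK = S.weylM d

lemma matLevel_zero_zero {g : S.GG} : g ∈ S.K0set ↔ S.matLevel 0 0 (S.mat g) := by
  simp only [matLevel, K0set, zero_mul, add_zero]
  exact forall₂_congr fun i j => mem_O_iff le_rfl (by norm_num)

lemma matLevel_one_zero {g : S.GG} : g ∈ S.K1set ↔ S.matLevel 1 0 (S.mat g) := by
  have hO : ∀ (k : ℤ) (x : S.E), k ≤ 0 → 0 ≤ k + 1 → (x ∈ S.halfD k ↔ x ∈ S.O) :=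
    fun k x h h' => (mem_O_iff h h').symm
  have hp : ∀ (k : ℤ) (x : S.E), 1 ≤ k → k ≤ 2 → (x ∈ S.halfD k ↔ x ∈ S.pE 1) :=
    fun k x h h' => (mem_pE_iff (by omega) (by omega)).symm
  rw [matLevel_iff, hO 0, hO (0 - 1), hp (0 + 1), hO 0, hO (0 - 1), hp (0 + 2 * 1), hp (0 + 1),
    hO 0, ← mem_pE_iff (m := -1)]
  · simp only [K1set, Set.mem_ofPred_eq, and_assoc]
  all_goals norm_num

lemma mat_alphaE_inv : S.mat S.alphaE⁻¹ = S.alphaMinv := rfl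

lemma exists_isLevel (C : Chamber S) : ∃ d, C.IsLevel d := by
  have hzero : ∀ k, (0 : S.E) ∈ S.pE k := fun k => ⟨0, S.O.zero_mem, by simp⟩
  rcases C.cases with ⟨hK, hKo, hI, hI1, -, hβ, -⟩ | ⟨hK, hKo, hI, hI1, -, hβ, -⟩
  · refine ⟨0, ?_⟩
    have hm : ∀ g, g ∈ C.K ↔ S.matLevel 0 0 (S.mat g) := fun g => by
      rw [← SetLike.mem_coe, hK, matLevel_zero_zero]
    refine ⟨hm, fun g hg => ?_, fun g => ?_, fun g hg x y hxy => ?_, ?_⟩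
    · rw [hKo]
      intro i j
      rw [mem_pE_iff (k := 1) (by norm_num) (by norm_num)]
      simpa using hg i j
    · rw [H0, hI, ← SetLike.mem_coe, hK]
      refine ⟨fun h => ⟨h.1, h.2.1⟩, ?_⟩
      rintro ⟨h, h'⟩
      refine ⟨h, h', ?_⟩
      obtain ⟨a, b, c, e⟩ := h
      simp [e, hzero]
    · rw [hI1]
      rw [← SetLike.mem_coe, hK] at hg
      simp [I1K0, IK0, hg, hxy, hzero, nM]
    · rw [hβ]
      ext i j
      fin_cases i <;> fin_cases j <;> simp [weylM, betaE, betaU, betaM, mat]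
  · refine ⟨1, ?_⟩
    have hm : ∀ g, g ∈ C.K ↔ S.matLevel 1 0 (S.mat g) := fun g => by
      rw [← SetLike.mem_coe, hK, matLevel_one_zero]
    refine ⟨hm, fun g hg => ?_, fun g => ?_, fun g hg x y hxy => ?_, ?_⟩
    · have h1 : S.matLevel 1 0 (1 : S.M3) := by
        rw [← mat_one, ← hm]
        exact one_mem _
      have h0 : S.matLevel 1 0 (S.mat g) := fun i j => by
        simpa using add_mem ((hg.mono (by norm_num : (0 : ℤ) ≤ 1)) i j) (h1 i j)
      rw [matLevel_iff] at hg
      simp at hg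
      rw [hKo]
      refine ⟨matLevel_one_zero.2 h0, (mem_O_iff (k := -1) (by norm_num) (by norm_num)).2 hg.1.2.2,
        (mem_pE_iff (k := 3) (by norm_num) (by norm_num)).2 hg.2.2.1,
        (mem_pE_iff (k := 1) (by norm_num) (by norm_num)).2 hg.1.1,
        (mem_pE_iff (k := 1) (by norm_num) (by norm_num)).2 hg.2.1.2.1,
        (mem_pE_iff (k := 1) (by norm_num) (by norm_num)).2 hg.2.2.2.2⟩
    · rw [H0, hI, ← SetLike.mem_coe, hK]
      refine ⟨fun h => ⟨h.1, h.2.1⟩, ?_⟩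
      rintro ⟨h, h'⟩
      refine ⟨h, h', ?_⟩
      obtain ⟨a, b, c, e⟩ := h
      simp [e, hzero]
    · rw [hI1]
      rw [← SetLike.mem_coe, hK] at hg
      simp [I1K1, IK1, hg, hxy, hzero, nM]
    · rw [hβ, betaPr, mat_mul, mat_alphaE_inv]
      ext i j
      fin_cases i <;> fin_cases j <;>
        simp [weylM, betaE, betaU, betaM, mat, alphaMinv, Matrix.mul_apply, Fin.sum_univ_three]

end Chamber

namespace Setting
variable {S : Setting}

lemma mat_alphaE_pow (n : ℕ) :
    S.mat (S.alphaE ^ n) = !![S.ϖ⁻¹ ^ n, 0, 0; 0, 1, 0; 0, 0, S.ϖ ^ n] := by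
  induction n with
  | zero =>
    ext i j
    fin_cases i <;> fin_cases j <;> simp [mat_one]
  | succ n ih =>
    have h : S.mat S.alphaE = S.alphaM := rfl
    rw [pow_succ, mat_mul, ih, h]
    ext i j
    fin_cases i <;> fin_cases j <;>
      simp [alphaM, Matrix.mul_apply, Fin.sum_univ_three, pow_succ, mul_comm]

lemma mat_pow_of_lowU {u : S.GG} {x y : S.E} (hu : S.mat u = S.n'M x y) (n : ℕ) :
    S.mat (u ^ n) = S.n'M (n * x) (n * y - (n.choose 2 : ℕ) * (S.conj x * x)) := by
  induction n with
  | zero =>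
    ext i j
    fin_cases i <;> fin_cases j <;> simp [mat_one, n'M]
  | succ n ih =>
    rw [pow_succ, mat_mul, ih, hu]
    ext i j
    fin_cases i <;> fin_cases j <;>
      simp [n'M, Matrix.mul_apply, Fin.sum_univ_three, Nat.choose_succ_succ n 1] <;> ring

lemma p_mem_halfD : (S.p : S.E) ∈ S.halfD 2 := by
  have h1 : ((S.p ^ (S.fdeg * 2) : ℕ) : S.E) ∈ S.halfD 2 := by
    have h : ((Fintype.card S.kE : ℕ) : S.kE) = 0 := by
      rw [← Nat.card_eq_fintype_card, ← nsmul_one]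
      exact card_nsmul_eq_zero'
    rw [S.card_res, S.hq, ← pow_mul, ← map_natCast (Ideal.Quotient.mk S.mI),
      Ideal.Quotient.eq_zero_iff_mem, S.hmI] at h
    obtain ⟨y, hy, h⟩ := h
    exact ⟨1, by norm_num, y, hy, by rw [zpow_one, ← h]; simp⟩
  by_contra h
  obtain ⟨h0, hi⟩ := inv_mem_halfD (l := -1) h (by norm_num)
  rw [← mem_O_iff (by norm_num) (by norm_num)] at hi
  apply one_notMem_halfD_one (S := S)
  have h2 := mul_mem_halfD (n := 1) h1
    ((mem_O_iff (k := 0) le_rfl (by norm_num)).1 (S.O.pow_mem hi (S.fdeg * 2))) (by norm_num)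
  rwa [Nat.cast_pow, ← mul_pow, mul_inv_cancel₀ h0, one_pow] at h2

lemma exists_residue (k : ℤ) : ∃ r : S.E → S.kE, ∀ x ∈ S.halfD k, ∀ y ∈ S.halfD k,
    r x = r y → x - y ∈ S.halfD (1 + k) := by
  have h1 : k ≤ 2 * ((k + 1) / 2) := by omega
  have h2 : 2 * ((k + 1) / 2) ≤ k + 1 := by omega
  generalize (k + 1) / 2 = m at h1 h2
  refine ⟨fun x => if h : S.ϖ ^ (-m) * x ∈ S.O then S.resmap ⟨_, h⟩ else 0,
    fun x hx y hy hxy => ?_⟩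
  have hO : ∀ x ∈ S.halfD k, S.ϖ ^ (-m) * x ∈ S.O := by
    intro x hx
    obtain ⟨w, hw, rfl⟩ := (mem_pE_iff h1 h2).2 hx
    rwa [← mul_assoc, ← zpow_add₀ S.unif_ne, neg_add_cancel, zpow_zero, one_mul]
  simp only [hO x hx, hO y hy, dif_pos] at hxy
  rw [resmap, Ideal.Quotient.eq, S.hmI] at hxy
  obtain ⟨w, hw, h⟩ := hxy
  refine ⟨m + 1, by omega, w, hw, ?_⟩
  have h' : S.ϖ ^ (-m) * x - S.ϖ ^ (-m) * y = S.ϖ * w := h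
  rw [zpow_add₀ S.unif_ne, zpow_one, mul_assoc, ← h', ← mul_sub, ← mul_assoc,
    ← zpow_add₀ S.unif_ne, add_neg_cancel, zpow_zero, one_mul]

end Setting

namespace Chamber
open Setting
variable {S : Setting} {C : Chamber S} {d : ℤ}

namespace IsLevel

lemma βK_mem (hd : C.IsLevel d) : C.βK ∈ C.K := by
  rw [hd.mem_K, hd.mat_βK]
  exact matLevel_weylM d

lemma βK_mul_βK (hd : C.IsLevel d) : C.βK * C.βK = 1 := by
  apply mat_injective
  rw [mat_mul, hd.mat_βK, mat_one]
  have h : S.ϖ ^ (-d) * S.ϖ ^ d = 1 := by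
    rw [← zpow_add₀ S.unif_ne, neg_add_cancel, zpow_zero]
  ext i j
  fin_cases i <;> fin_cases j <;>
    simp [weylM, Matrix.mul_apply, Fin.sum_univ_three, zpow_ne_zero, S.unif_ne]

lemma cartan_of_corner (hd : C.IsLevel d) {m : ℤ} (hm : m ≤ 0) {g : S.GG}
    (hg : S.matLevel d m (S.mat g)) (h00 : S.mat g 0 0 ∉ S.halfD (m + 1)) :
    ∃ k₁ ∈ C.K, ∃ k₂ ∈ C.K, ∃ n : ℕ, g = k₁ * S.alphaE ^ n * k₂ := by
  obtain ⟨h0, hinv⟩ := inv_mem_halfD (l := -m) h00 (by omega)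
  obtain ⟨u, h, n, hg', ⟨x, y, -, hu, hx, hy⟩, ⟨z, w, -, hn, hz, hw⟩, e, he, hh⟩ := gauss g h0
  have hL := matLevel_iff.1 hg
  have hu' : u ∈ C.K := by
    rw [hd.mem_K, hu, hx, hy]
    exact matLevel_n'M (mul_mem_halfD hL.2.1.1 hinv (by omega))
      (mul_mem_halfD hL.2.2.1 hinv (by omega))
  have hn' : n ∈ C.K := by
    rw [hd.mem_K, hn, hz, hw]
    exact matLevel_nM (mul_mem_halfD hL.1.2.1 hinv (by omega))
      (mul_mem_halfD hL.1.2.2 hinv (by omega))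
  obtain ⟨k, v, hv⟩ := S.disc _ h0
  have hk : k ≤ 0 := by
    by_contra hk
    exact h00 ⟨k, by omega, (v : S.O), (v : S.O).2, by rw [hv]; ring⟩
  obtain ⟨N, hN⟩ := Int.exists_eq_neg_ofNat hk
  have hϖ : S.ϖ ^ N ≠ 0 := pow_ne_zero _ S.unif_ne
  have hv1 : ((v : S.O) : S.E) * ((v⁻¹ : S.Oˣ) : S.O) = 1 :=
    congrArg Subtype.val v.mul_inv
  have hh' : S.mat ((S.alphaE ^ N)⁻¹ * h) =
      !![((v : S.O) : S.E), 0, 0; 0, e, 0; 0, 0, S.conj ((v⁻¹ : S.Oˣ) : S.O)] := by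
    have hc : S.conj ((v⁻¹ : S.Oˣ) : S.O) = (S.conj (v : S.O))⁻¹ := by
      rw [← map_inv₀, inv_eq_of_mul_eq_one_right hv1]
    rw [mat_mul, mat_inv, mat_alphaE_pow, hh, hv, hN, hc]
    ext i j
    fin_cases i <;> fin_cases j <;>
      simp [adjM, Matrix.mul_apply, Fin.sum_univ_three, Fin.rev, S.unif_conj] <;> field_simp
  have hmem : (S.alphaE ^ N)⁻¹ * h ∈ C.K := by
    rw [hd.mem_K, hh', matLevel_iff]
    have hO : ∀ x ∈ S.O, x ∈ S.halfD 0 := fun x => (mem_O_iff le_rfl (by norm_num)).1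
    have he' : e ∈ S.halfD 0 :=
      mem_halfD_of_norm (l := 0) (by norm_num) (by rw [he]; exact one_mem_halfD le_rfl)
    simp [zero_mem, hO, he', S.conj_O]
  exact ⟨u, hu', _, mul_mem hmem hn', N, by rw [hg']; group⟩

lemma cartan (hd : C.IsLevel d) (g : S.GG) :
    ∃ k₁ ∈ C.K, ∃ k₂ ∈ C.K, ∃ n : ℕ, g = k₁ * S.alphaE ^ n * k₂ := by
  obtain ⟨m, hm, hm'⟩ := exists_maximal_level d g
  rcases le_or_gt 0 m with h0 | h0
  · exact ⟨g, (hd.mem_K g).2 (hm.mono h0), 1, one_mem _, 0, by simp⟩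
  have hβ := hd.βK_mem
  have hββ := hd.βK_mul_βK
  have hβL := (hd.mem_K _).1 hβ
  have hϖ : S.ϖ ^ d ≠ 0 := zpow_ne_zero _ S.unif_ne
  have hl : S.matLevel d m (S.mat (C.βK * g)) := by
    simpa [mat_mul] using hβL.mul hm
  have hr : S.matLevel d m (S.mat (g * C.βK)) := by
    simpa [mat_mul] using hm.mul hβL
  have hlr : S.matLevel d m (S.mat (C.βK * g * C.βK)) := by
    rw [mat_mul]
    simpa using hl.mul hβL
  rcases exists_corner h0 hm hm' with h | h | h | h
  · exact hd.cartan_of_corner h0.le hm h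
  · obtain ⟨k₁, h₁, k₂, h₂, n, e⟩ := hd.cartan_of_corner h0.le hr (fun hc => h (by
      have := mul_mem_halfD (n := m + 1 - 2 * d) hc
        (unif_zpow_mem_halfD (n := -d) le_rfl) (by omega)
      simpa [mat_mul_apply, hd.mat_βK, weylM, hϖ] using this))
    refine ⟨k₁, h₁, k₂ * C.βK, mul_mem h₂ hβ, n, ?_⟩
    rw [← mul_assoc, ← e, mul_assoc, hββ, mul_one]
  · obtain ⟨k₁, h₁, k₂, h₂, n, e⟩ := hd.cartan_of_corner h0.le hl (fun hc => h (by
      have := mul_mem_halfD (n := m + 1 + 2 * d) hc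
        (unif_zpow_mem_halfD (n := d) le_rfl) (by omega)
      simpa [mat_mul_apply, hd.mat_βK, weylM, hϖ, mul_right_comm] using this))
    refine ⟨C.βK * k₁, mul_mem hβ h₁, k₂, h₂, n, ?_⟩
    rw [mul_assoc, mul_assoc, ← mul_assoc k₁, ← e, ← mul_assoc, hββ, one_mul]
  · obtain ⟨k₁, h₁, k₂, h₂, n, e⟩ := hd.cartan_of_corner h0.le hlr (fun hc => h (by
      simpa [mat_mul_apply, hd.mat_βK, weylM, hϖ, mul_right_comm] using hc))
    refine ⟨C.βK * k₁, mul_mem hβ h₁, k₂ * C.βK, mul_mem h₂ hβ, n, ?_⟩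
    calc g = C.βK * C.βK * g * (C.βK * C.βK) := by rw [hββ, one_mul, mul_one]
      _ = C.βK * (C.βK * g * C.βK) * C.βK := by group
      _ = _ := by rw [e]; group

lemma gauss_of_notMem (hd : C.IsLevel d) {k : S.GG} (hk : k ∈ C.K)
    (h00 : S.mat k 0 0 ∉ S.halfD 1) :
    ∃ u h n : S.GG, k = u * h * n ∧ u ∈ C.K ∧ h ∈ C.H0 ∧ n ∈ S.Nset ∩ C.K ∧
      ∃ x y, x * S.conj x + y + S.conj y = 0 ∧ S.mat u = S.n'M x y ∧
        x = S.mat k 1 0 * (S.mat k 0 0)⁻¹ ∧ y = S.mat k 2 0 * (S.mat k 0 0)⁻¹ := by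
  obtain ⟨h0, hinv⟩ := inv_mem_halfD (l := 0) h00 (by omega)
  obtain ⟨u, h, n, hg', ⟨x, y, hxy, hu, hx, hy⟩, ⟨z, w, hzw, hn, hz, hw⟩, e, he, hh⟩ := gauss k h0
  have hL := matLevel_iff.1 ((hd.mem_K _).1 hk)
  have hu' : u ∈ C.K := by
    rw [hd.mem_K, hu, hx, hy]
    exact matLevel_n'M (mul_mem_halfD hL.2.1.1 hinv (by omega))
      (mul_mem_halfD hL.2.2.1 hinv (by omega))
  have hn' : n ∈ C.K := by
    rw [hd.mem_K, hn, hz, hw]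
    exact matLevel_nM (mul_mem_halfD hL.1.2.1 hinv (by omega))
      (mul_mem_halfD hL.1.2.2 hinv (by omega))
  have hh' : h ∈ C.K := by
    have : h = u⁻¹ * k * n⁻¹ := by rw [hg']; group
    rw [this]
    exact mul_mem (mul_mem (inv_mem hu') hk) (inv_mem hn')
  exact ⟨u, h, n, hg', hu', (hd.mem_H0 _).2 ⟨⟨_, _, _, hh⟩, hh'⟩, ⟨⟨z, w, hzw, hn⟩, hn'⟩,
    x, y, hxy, hu, hx, hy⟩

lemma bruhat (hd : C.IsLevel d) {k : S.GG} (hk : k ∈ C.K) :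
    (∃ u ∈ S.lowU ⊓ C.K, ∃ h ∈ C.H0, ∃ n ∈ S.Nset ∩ C.K, k = u * h * n) ∨
    (∃ z ∈ C.K, z ∈ C.KoneS ∧ ∃ h ∈ C.H0, ∃ n ∈ S.Nset ∩ C.K, k = C.βK * z * h * n) := by
  by_cases h00 : S.mat k 0 0 ∈ S.halfD 1
  swap
  · obtain ⟨u, h, n, e, hu, hh, hn, x, y, hxy, hu', -⟩ := hd.gauss_of_notMem hk h00
    exact Or.inl ⟨u, ⟨⟨x, y, hxy, hu'⟩, hu⟩, h, hh, n, hn, e⟩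
  right
  have hkL := (hd.mem_K _).1 hk
  have hL := matLevel_iff.1 hkL
  have h10 : S.mat k 1 0 ∈ S.halfD (1 + d) := by
    simpa using hkL.middle_row 0 (by simpa using h00) (by simp [betaM])
  have hϖ : S.ϖ ^ d ≠ 0 := zpow_ne_zero _ S.unif_ne
  have e00 : S.mat (C.βK * k) 0 0 = S.ϖ ^ (-d) * S.mat k 2 0 := by
    simp [mat_mul_apply, hd.mat_βK, weylM]
  have e10 : S.mat (C.βK * k) 1 0 = S.mat k 1 0 := by
    simp [mat_mul_apply, hd.mat_βK, weylM]
  have e20 : S.mat (C.βK * k) 2 0 = S.ϖ ^ d * S.mat k 0 0 := by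
    simp [mat_mul_apply, hd.mat_βK, weylM]
  have hb : S.mat (C.βK * k) 0 0 ∉ S.halfD 1 := by
    intro hc
    have h20 : S.mat k 2 0 ∈ S.halfD (1 + 2 * d) := by
      have := mul_mem_halfD (n := 1 + 2 * d) hc
        (unif_zpow_mem_halfD (n := d) le_rfl) (by omega)
      simpa [e00, hϖ, mul_right_comm] using this
    apply one_notMem_halfD_one (S := S)
    have := mat_col k 0 2
    simp only [betaM] at this
    rw [show (1 : S.E) = !![0,0,1;0,1,0;1,0,0] 0 2 by simp, ← this]
    exact add_mem (add_mem (mul_mem_halfD h00 (conj_mem_halfD hL.2.2.2.2) (by omega))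
      (mul_mem_halfD h10 (conj_mem_halfD hL.2.1.2.2) (by omega)))
      (mul_mem_halfD h20 (conj_mem_halfD hL.1.2.2) (by omega))
  obtain ⟨u, h, n, e, hu, hh, hn, x, y, hxy, hu', hx, hy⟩ :=
    hd.gauss_of_notMem (mul_mem hd.βK_mem hk) hb
  obtain ⟨-, hinv⟩ := inv_mem_halfD (l := 0) hb (by omega)
  refine ⟨u, hu, hd.mem_KoneS _ ?_, h, hh, n, hn, ?_⟩
  · rw [hu']
    apply matLevel_n'M_sub_one
    · rw [hx, e10]
      exact mul_mem_halfD h10 hinv (by omega)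
    · rw [hy, e20]
      exact mul_mem_halfD (mul_mem_halfD (unif_zpow_mem_halfD le_rfl) h00 le_rfl) hinv (by omega)
  · rw [mul_assoc, mul_assoc, ← mul_assoc u, ← e, ← mul_assoc, hd.βK_mul_βK, one_mul]

lemma level_of_lowU (hd : C.IsLevel d) {u : S.GG} (hu : u ∈ S.lowU ⊓ C.K) :
    ∃ x ∈ S.halfD d, ∃ y ∈ S.halfD (2 * d), x * S.conj x + y + S.conj y = 0 ∧
      S.mat u = S.n'M x y := by
  have hK : u ∈ C.K := hu.2
  obtain ⟨x, y, hxy, hu⟩ := hu.1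
  rw [hd.mem_K, hu, matLevel_iff] at hK
  simp only [zero_add] at hK
  exact ⟨x, hK.2.1.1, y, hK.2.2.1, hxy, hu⟩

lemma pow_mem_KoneS (hd : C.IsLevel d) {u : S.GG} (hu : u ∈ S.lowU ⊓ C.K) :
    u ^ S.p ∈ C.KoneS := by
  obtain ⟨x, hx, y, hy, -, e⟩ := hd.level_of_lowU hu
  apply hd.mem_KoneS
  rw [mat_pow_of_lowU e]
  obtain ⟨c, hc⟩ := S.hp.dvd_choose_self (k := 2) (by norm_num)
    (lt_of_le_of_ne S.hp.two_le S.hodd.symm)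
  have hc' : (c : S.E) ∈ S.halfD 0 :=
    (mem_O_iff le_rfl (by norm_num)).1 (natCast_mem S.O c)
  apply matLevel_n'M_sub_one
  · exact mul_mem_halfD p_mem_halfD hx (by omega)
  · refine sub_mem (mul_mem_halfD p_mem_halfD hy (by omega)) ?_
    rw [hc, Nat.cast_mul]
    exact mul_mem_halfD (mul_mem_halfD p_mem_halfD hc' le_rfl)
      (mul_mem_halfD (conj_mem_halfD hx) hx le_rfl) (by omega)

lemma exists_finite_invariant (hd : C.IsLevel d) : ∃ f : S.GG → S.kE × S.kE,
    ∀ u ∈ S.lowU ⊓ C.K, ∀ v ∈ S.lowU ⊓ C.K, f u = f v → u⁻¹ * v ∈ C.KoneS := by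
  obtain ⟨r, hr⟩ := exists_residue (S := S) d
  obtain ⟨s, hs⟩ := exists_residue (S := S) (2 * d)
  refine ⟨fun g => (r (S.mat g 1 0), s (S.mat g 2 0)), fun u hu v hv huv => ?_⟩
  obtain ⟨x, hx, y, hy, hxy, hu⟩ := hd.level_of_lowU hu
  obtain ⟨x', hx', y', hy', -, hv⟩ := hd.level_of_lowU hv
  simp only [Prod.mk.injEq] at huv
  rw [hu, hv] at huv
  have h1 := hr _ hx' _ hx huv.1.symm
  have h2 := hs _ hy' _ hy huv.2.symm
  apply hd.mem_KoneS
  have e : S.mat (u⁻¹ * v) = S.n'M (x' - x) (y' - y + S.conj x * (x' - x)) := by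
    rw [mat_mul, mat_inv, hu, hv]
    ext i j
    fin_cases i <;> fin_cases j <;>
      simp [n'M, adjM, Matrix.mul_apply, Fin.sum_univ_three, Fin.rev, S.conj_invol]
    · ring
    · linear_combination hxy
    · ring
  rw [e]
  exact matLevel_n'M_sub_one h1
    (add_mem h2 (mul_mem_halfD (conj_mem_halfD hx) h1 (by omega)))

end IsLevel
end Chamber

section PGroup
variable {p : ℕ} {𝔽 V Q : Type} [Field 𝔽] [AddCommGroup V] [Module 𝔽 V] [Group Q]

lemma exists_invariant_of_isPGroup [Fact p.Prime] [Algebra (ZMod p) 𝔽] [Finite Q]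
    (hQ : IsPGroup p Q) (ρ : Representation 𝔽 Q V) [Nontrivial V] :
    ∃ v ≠ 0, ∀ g, ρ g v = v := by
  obtain ⟨v, hv⟩ := exists_ne (0 : V)
  let _ : Module (ZMod p) V := Module.compHom V (algebraMap (ZMod p) 𝔽)
  let A : Submodule (ZMod p) V := Submodule.span (ZMod p) (Set.range fun g => ρ g v)
  have hstab : ∀ g, ∀ a ∈ A, ρ g a ∈ A := by
    intro g a ha
    induction ha using Submodule.span_induction with
    | mem a h =>
      obtain ⟨k, rfl⟩ := h
      exact Submodule.subset_span ⟨g * k, by simp⟩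
    | zero => simp
    | add a b _ _ ha hb => rw [map_add]; exact add_mem ha hb
    | smul c a _ ha =>
      have : ρ g (c • a) = c • ρ g a := (ρ g).map_smul (algebraMap (ZMod p) 𝔽 c) a
      rw [this]
      exact A.smul_mem c ha
  let _ : MulAction Q A :=
    { smul := fun g a => ⟨ρ g a, hstab g a a.2⟩
      one_smul := fun a => Subtype.ext (by change ρ 1 (a : V) = a; simp)
      mul_smul := fun g h a => Subtype.ext (by change ρ (g * h) (a : V) = ρ g (ρ h a); simp) }
  have : Module.Finite (ZMod p) A := Module.Finite.span_of_finite _ (Set.finite_range _)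
  have : Finite A := Module.finite_of_finite (ZMod p)
  have hvA : v ∈ A := Submodule.subset_span ⟨1, by simp⟩
  have : Nontrivial A := ⟨⟨v, hvA⟩, 0, fun h => hv (congrArg Subtype.val h)⟩
  have hcard : p ∣ Nat.card A := by
    rw [Module.natCard_eq_pow_finrank (K := ZMod p), Nat.card_zmod]
    exact dvd_pow_self p (Module.finrank_pos).ne'
  obtain ⟨b, hb, hb0⟩ := hQ.exists_fixed_point_of_prime_dvd_card_of_fixed_point A hcard
    (a := 0) (fun g => Subtype.ext (map_zero (ρ g)))
  exact ⟨b, fun h => hb0 (Subtype.ext h.symm), fun g => congrArg Subtype.val (hb g)⟩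

lemma coinvariantsKer_ne_top [Fact p.Prime] [Algebra (ZMod p) 𝔽] [Nontrivial V]
    (ρ : Representation 𝔽 Q V) (hfin : (Set.range ρ).Finite) (hp : ∀ g, ρ (g ^ p) = 1) :
    Representation.Coinvariants.ker ρ ≠ ⊤ := by
  have : Finite ρ.toHomUnits.range := by
    have := hfin.to_subtype
    refine Finite.of_injective
      (fun u : ρ.toHomUnits.range => (⟨u.1.1, ?_⟩ : Set.range ρ)) ?_
    · obtain ⟨g, hg⟩ := u.2
      exact ⟨g, by rw [← hg]; rfl⟩
    · intro u v h
      exact Subtype.ext (Units.ext (congrArg Subtype.val h))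
  have hQ : IsPGroup p ρ.toHomUnits.range := by
    rintro ⟨_, g, rfl⟩
    exact ⟨1, Subtype.ext (Units.ext (by simpa using hp g))⟩
  obtain ⟨ℓ, hℓ, hfix⟩ := exists_invariant_of_isPGroup hQ
    (Representation.dual (((Units.coeHom _).comp ρ.toHomUnits.range.subtype :
      Representation 𝔽 ρ.toHomUnits.range V)))
  intro htop
  apply hℓ
  ext v
  have hv : v ∈ Representation.Coinvariants.ker ρ := htop ▸ Submodule.mem_top
  rw [LinearMap.zero_apply]
  induction hv using Submodule.span_induction with
  | mem a h =>
    obtain ⟨⟨g, w⟩, rfl⟩ := h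
    have := LinearMap.congr_fun (hfix (⟨ρ.toHomUnits g, g, rfl⟩)⁻¹) w
    rw [map_sub, sub_eq_zero]
    rw [Representation.dual_apply, inv_inv] at this
    exact this
  | zero => simp
  | add a b _ _ ha hb => rw [map_add, ha, hb, add_zero]
  | smul c a _ ha => rw [map_smul, ha, smul_zero]

end PGroup

namespace Chamber
open Setting

namespace IsLevel
variable {S : Setting} {C : Chamber S} {d : ℤ}

lemma mem_K_of_mem_H0 (hd : C.IsLevel d) {h : S.GG} (hh : h ∈ C.H0) : h ∈ C.K :=
  ((hd.mem_H0 h).1 hh).2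

lemma inv_conj_alphaE_pow_mem (hd : C.IsLevel d) {n : ℕ} (hn : n ≠ 0) {u : S.GG}
    (hu : u ∈ S.Nset ∩ C.K) :
    (S.alphaE ^ n)⁻¹ * u * S.alphaE ^ n ∈ (C.K : Set S.GG) ∩ C.KoneS := by
  have hK : u ∈ C.K := hu.2
  obtain ⟨x, y, hxy, hu⟩ := hu.1
  rw [hd.mem_K, hu, matLevel_iff] at hK
  have e : S.mat ((S.alphaE ^ n)⁻¹ * u * S.alphaE ^ n) =
      S.nM (S.ϖ ^ n * x) (S.ϖ ^ n * S.ϖ ^ n * y) := by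
    have hϖ := S.unif_ne
    rw [mat_mul, mat_mul, mat_inv, mat_alphaE_pow, hu]
    ext i j
    fin_cases i <;> fin_cases j <;>
      simp [nM, adjM, Matrix.mul_apply, Fin.sum_univ_three, Fin.rev, S.unif_conj, hϖ] <;> ring
  have hϖ : S.ϖ ^ n ∈ S.halfD 1 := by
    simpa using unif_zpow_mem_halfD (S := S) (k := 1) (n := n) (by omega)
  have hx : S.ϖ ^ n * x ∈ S.halfD (1 - d) := mul_mem_halfD hϖ hK.1.2.1 (by omega)
  have hy : S.ϖ ^ n * S.ϖ ^ n * y ∈ S.halfD (1 - 2 * d) :=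
    mul_mem_halfD (mul_mem_halfD (n := 1) hϖ hϖ (by omega)) hK.1.2.2 (by omega)
  refine ⟨(hd.mem_K _).2 ?_, hd.mem_KoneS _ ?_⟩
  · rw [e]
    exact matLevel_nM (halfD_mono (by omega) hx) (halfD_mono (by omega) hy)
  · rw [e]
    exact matLevel_nM_sub_one hx hy

lemma conj_alphaE_pow_mem (hd : C.IsLevel d) {n : ℕ} (hn : n ≠ 0) {u : S.GG}
    (hu : u ∈ S.lowU ⊓ C.K) :
    S.alphaE ^ n * u * (S.alphaE ^ n)⁻¹ ∈ (C.K : Set S.GG) ∩ C.KoneS := by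
  obtain ⟨x, hx, y, hy, -, hu⟩ := hd.level_of_lowU hu
  have e : S.mat (S.alphaE ^ n * u * (S.alphaE ^ n)⁻¹) =
      S.n'M (S.ϖ ^ n * x) (S.ϖ ^ n * S.ϖ ^ n * y) := by
    have hϖ := S.unif_ne
    rw [mat_mul, mat_mul, mat_inv, mat_alphaE_pow, hu]
    ext i j
    fin_cases i <;> fin_cases j <;>
      simp [n'M, adjM, Matrix.mul_apply, Fin.sum_univ_three, Fin.rev, S.unif_conj, hϖ] <;> ring
  have hϖ : S.ϖ ^ n ∈ S.halfD 1 := by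
    simpa using unif_zpow_mem_halfD (S := S) (k := 1) (n := n) (by omega)
  have hx' : S.ϖ ^ n * x ∈ S.halfD (1 + d) := mul_mem_halfD hϖ hx (by omega)
  have hy' : S.ϖ ^ n * S.ϖ ^ n * y ∈ S.halfD (1 + 2 * d) :=
    mul_mem_halfD (mul_mem_halfD (n := 1) hϖ hϖ (by omega)) hy (by omega)
  refine ⟨(hd.mem_K _).2 ?_, hd.mem_KoneS _ ?_⟩
  · rw [e]
    exact matLevel_n'M (halfD_mono (by omega) hx') (halfD_mono (by omega) hy')
  · rw [e]
    exact matLevel_n'M_sub_one hx' hy'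

lemma commute_alphaE_pow (hd : C.IsLevel d) {h : S.GG} (hh : h ∈ C.H0) (n : ℕ) :
    h * S.alphaE ^ n = S.alphaE ^ n * h := by
  obtain ⟨⟨a, b, c, e⟩, -⟩ := (hd.mem_H0 h).1 hh
  apply mat_injective
  rw [mat_mul, mat_mul, mat_alphaE_pow, e]
  ext i j
  fin_cases i <;> fin_cases j <;> simp [Matrix.mul_apply, Fin.sum_univ_three, mul_comm]

lemma βK_conj_mem_H0 (hd : C.IsLevel d) {h : S.GG} (hh : h ∈ C.H0) :
    C.βK * h * C.βK ∈ C.H0 := by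
  obtain ⟨⟨a, b, c, e⟩, hK⟩ := (hd.mem_H0 h).1 hh
  refine (hd.mem_H0 _).2 ⟨⟨S.ϖ ^ (-d) * c * S.ϖ ^ d, b, S.ϖ ^ d * a * S.ϖ ^ (-d), ?_⟩,
    mul_mem (mul_mem hd.βK_mem hK) hd.βK_mem⟩
  rw [mat_mul, mat_mul, hd.mat_βK, e]
  ext i j
  fin_cases i <;> fin_cases j <;> simp [weylM, Matrix.mul_apply, Fin.sum_univ_three]

lemma conj_mem_lowU (hd : C.IsLevel d) {h u : S.GG} (hh : h ∈ C.H0) (hu : u ∈ S.lowU ⊓ C.K) :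
    h * u * h⁻¹ ∈ S.lowU ⊓ C.K := by
  obtain ⟨⟨a, b, c, e⟩, hK⟩ := (hd.mem_H0 h).1 hh
  have hK' : h * u * h⁻¹ ∈ C.K := mul_mem (mul_mem hK hu.2) (inv_mem hK)
  refine ⟨?_, hK'⟩
  obtain ⟨x, y, hxy, hu⟩ := hu.1
  have h0 := mat_col h 0 2
  have h1 := mat_col h 1 1
  have h2 := mat_col h 2 0
  simp [e, betaM] at h0 h1 h2
  refine ⟨b * x * S.conj c, c * y * S.conj c, ?_, ?_⟩
  · simp only [map_mul, S.conj_invol]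
    linear_combination c * S.conj c * hxy + x * S.conj x * c * S.conj c * h1
  · rw [mat_mul, mat_mul, mat_inv, hu, e]
    ext i j
    fin_cases i <;> fin_cases j <;>
      simp [n'M, adjM, Matrix.mul_apply, Fin.sum_univ_three, Fin.rev, S.conj_invol, h0, h1, h2]
    ring

end IsLevel
end Chamber

section Weights
open Setting
variable {S : Setting} {C : Chamber S} {d : ℤ} {𝔽 : Type} [Field 𝔽]
  {W : Type} [AddCommGroup W] [Module 𝔽 W] {σ : Representation 𝔽 ↥C.K W}

lemma sigma'_of_mem {g : S.GG} (hg : g ∈ C.K) : sigma' C 𝔽 W σ g = σ ⟨g, hg⟩ := dif_pos hg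

lemma sigma'_mul {g h : S.GG} (hg : g ∈ C.K) (hh : h ∈ C.K) (w : W) :
    sigma' C 𝔽 W σ (g * h) w = sigma' C 𝔽 W σ g (sigma' C 𝔽 W σ h w) := by
  rw [sigma'_of_mem hg, sigma'_of_mem hh, sigma'_of_mem (mul_mem hg hh)]
  exact LinearMap.congr_fun (map_mul σ ⟨g, hg⟩ ⟨h, hh⟩) w

lemma sigma'_one (w : W) : sigma' C 𝔽 W σ 1 w = w := by
  rw [sigma'_of_mem (one_mem _)]
  exact LinearMap.congr_fun (map_one σ) w

lemma IsWeight.sigma'_eq (hσ : IsWeight C 𝔽 W σ) {g : S.GG}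
    (hg : g ∈ (C.K : Set S.GG) ∩ C.KoneS) (w : W) : sigma' C 𝔽 W σ g w = w := by
  rw [sigma'_of_mem hg.1, hσ.2.2.2 g hg.1 hg.2, LinearMap.id_apply]

variable (σ) in
/-- The augmentation part of `σ` with respect to the lower unipotent elements of `K`. -/
def augmentation : Submodule 𝔽 W :=
  Representation.Coinvariants.ker
    (σ.comp (Subgroup.inclusion (inf_le_right : S.lowU ⊓ C.K ≤ C.K)) :
      Representation 𝔽 ↥(S.lowU ⊓ C.K) W)

lemma sub_mem_augmentation {u : S.GG} (hu : u ∈ S.lowU ⊓ C.K) (w : W) :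
    sigma' C 𝔽 W σ u w - w ∈ augmentation σ := by
  rw [sigma'_of_mem hu.2]
  exact Submodule.subset_span ⟨(⟨u, hu⟩, w), rfl⟩

lemma augmentation_le {N : Submodule 𝔽 W}
    (h : ∀ u ∈ S.lowU ⊓ C.K, ∀ w, sigma' C 𝔽 W σ u w - w ∈ N) : augmentation σ ≤ N := by
  refine Submodule.span_le.2 ?_
  rintro _ ⟨⟨u, w⟩, rfl⟩
  have := h u u.2 w
  rwa [sigma'_of_mem u.2.2] at this

lemma augmentation_ne_top (hd : C.IsLevel d) (hσ : IsWeight C 𝔽 W σ)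
    [Algebra (ZMod S.p) 𝔽] : augmentation σ ≠ ⊤ := by
  have := Fact.mk S.hp
  have := hσ.1
  have hone (u : ↥(S.lowU ⊓ C.K)) (hu : (u : S.GG) ∈ C.KoneS) :
      σ (Subgroup.inclusion (inf_le_right : S.lowU ⊓ C.K ≤ C.K) u) = 1 := hσ.2.2.2 u u.2.2 hu
  apply coinvariantsKer_ne_top (p := S.p)
  · obtain ⟨f, hf⟩ := hd.exists_finite_invariant
    have hfac : Function.FactorsThrough
        (σ.comp (Subgroup.inclusion (inf_le_right : S.lowU ⊓ C.K ≤ C.K)))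
        (fun u : ↥(S.lowU ⊓ C.K) => f u) := by
      intro u v huv
      have h := hone (u⁻¹ * v) (hf u u.2 v v.2 huv)
      rw [← MonoidHom.comp_apply, map_mul] at h
      rw [← mul_one (MonoidHom.comp σ _ u), ← h, ← mul_assoc, ← map_mul, mul_inv_cancel, map_one,
        one_mul]
    refine (Set.finite_range (Function.extend (fun u : ↥(S.lowU ⊓ C.K) => f u)
      (σ.comp (Subgroup.inclusion (inf_le_right : S.lowU ⊓ C.K ≤ C.K))) 1)).subset ?_
    rintro _ ⟨u, rfl⟩
    exact ⟨f u, hfac.extend_apply _ u⟩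
  · exact fun u => hone (u ^ S.p) (hd.pow_mem_KoneS u.2)

lemma sigma'_mem_augmentation (hd : C.IsLevel d) {h : S.GG} (hh : h ∈ C.H0) {w : W}
    (hw : w ∈ augmentation σ) : sigma' C 𝔽 W σ h w ∈ augmentation σ := by
  refine augmentation_le (N := (augmentation σ).comap (sigma' C 𝔽 W σ h)) (fun u hu w => ?_) hw
  have hK := hd.mem_K_of_mem_H0 hh
  rw [Submodule.mem_comap, map_sub, ← sigma'_mul hK hu.2,
    show h * u = h * u * h⁻¹ * h by group, sigma'_mul (hd.conj_mem_lowU hh hu).2 hK]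
  exact sub_mem_augmentation (hd.conj_mem_lowU hh hu) _

variable (σ) in
/-- `v` is a nonzero vector fixed by the upper unipotent elements of `K`, on which `H₀` acts
through `ψ`. -/
structure IsHighest (v : W) (ψ : S.GG → 𝔽) : Prop where
  ne_zero : v ≠ 0
  fixed : ∀ n ∈ S.Nset ∩ C.K, sigma' C 𝔽 W σ n v = v
  eigen : ∀ h ∈ C.H0, sigma' C 𝔽 W σ h v = ψ h • v

namespace IsHighest
variable {v : W} {ψ : S.GG → 𝔽}

lemma eigen_βK (hd : C.IsLevel d) (hv : IsHighest σ v ψ) {h : S.GG} (hh : h ∈ C.H0) :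
    sigma' C 𝔽 W σ h (sigma' C 𝔽 W σ C.βK v) =
      ψ (C.βK * h * C.βK) • sigma' C 𝔽 W σ C.βK v := by
  have hK := hd.mem_K_of_mem_H0 hh
  have hh' := hd.βK_conj_mem_H0 hh
  rw [← map_smul, ← hv.eigen _ hh', ← sigma'_mul hK hd.βK_mem,
    ← sigma'_mul hd.βK_mem (hd.mem_K_of_mem_H0 hh'), ← mul_assoc, ← mul_assoc, hd.βK_mul_βK,
    one_mul]

lemma sigma'_mem_sup (hd : C.IsLevel d) (hσ : IsWeight C 𝔽 W σ) (hv : IsHighest σ v ψ)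
    {k : S.GG} (hk : k ∈ C.K) : sigma' C 𝔽 W σ k v ∈
      augmentation σ ⊔ Submodule.span 𝔽 {v, sigma' C 𝔽 W σ C.βK v} := by
  rcases hd.bruhat hk with ⟨u, hu, h, hh, n, hn, rfl⟩ | ⟨z, hz, hz', h, hh, n, hn, rfl⟩
  · have hhK := hd.mem_K_of_mem_H0 hh
    rw [sigma'_mul (mul_mem hu.2 hhK) hn.2, hv.fixed n hn, sigma'_mul hu.2 hhK, hv.eigen h hh,
      ← sub_add_cancel (sigma' C 𝔽 W σ u _) (ψ h • v)]
    exact Submodule.add_mem_sup (sub_mem_augmentation hu _)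
      (Submodule.smul_mem _ _ (Submodule.subset_span (by simp)))
  · have hhK := hd.mem_K_of_mem_H0 hh
    have hβ := hd.βK_mem
    rw [sigma'_mul (mul_mem (mul_mem hβ hz) hhK) hn.2, hv.fixed n hn,
      sigma'_mul (mul_mem hβ hz) hhK, hv.eigen h hh, sigma'_mul hβ hz, hσ.sigma'_eq ⟨hz, hz'⟩,
      map_smul]
    exact Submodule.mem_sup_right (Submodule.smul_mem _ _ (Submodule.subset_span (by simp)))

lemma sup_eq_top (hd : C.IsLevel d) (hσ : IsWeight C 𝔽 W σ) (hv : IsHighest σ v ψ) :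
    augmentation σ ⊔ Submodule.span 𝔽 {v, sigma' C 𝔽 W σ C.βK v} = ⊤ := by
  rw [← top_le_iff]
  have hT := hσ.2.2.1 (Submodule.span 𝔽 {w | ∃ k ∈ C.K, w = sigma' C 𝔽 W σ k v}) (by
    intro k w hw
    rw [← Submodule.mem_comap]
    refine Submodule.span_le.2 ?_ hw
    rintro _ ⟨l, hl, rfl⟩
    refine Submodule.subset_span ⟨k * l, mul_mem k.2 hl, ?_⟩
    rw [sigma'_mul k.2 hl, sigma'_of_mem k.2])
  rcases hT with hT | hT
  · have : v ∈ Submodule.span 𝔽 {w | ∃ k ∈ C.K, w = sigma' C 𝔽 W σ k v} :=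
      Submodule.subset_span ⟨1, one_mem _, (sigma'_one v).symm⟩
    rw [hT] at this
    exact absurd this hv.ne_zero
  · rw [← hT, Submodule.span_le]
    rintro _ ⟨k, hk, rfl⟩
    exact hv.sigma'_mem_sup hd hσ hk

lemma exists_eq_add (hd : C.IsLevel d) (hσ : IsWeight C 𝔽 W σ) (hv : IsHighest σ v ψ) (w : W) :
    ∃ a ∈ augmentation σ, ∃ x y : 𝔽, w = a + (x • v + y • sigma' C 𝔽 W σ C.βK v) := by
  have hw : w ∈ augmentation σ ⊔ Submodule.span 𝔽 {v, sigma' C 𝔽 W σ C.βK v} :=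
    hv.sup_eq_top hd hσ ▸ Submodule.mem_top
  obtain ⟨a, ha, b, hb, rfl⟩ := Submodule.mem_sup.1 hw
  obtain ⟨x, y, rfl⟩ := Submodule.mem_span_pair.1 hb
  exact ⟨a, ha, x, y, rfl⟩

lemma mem_augmentation_of_eigen (hd : C.IsLevel d) (hσ : IsWeight C 𝔽 W σ)
    (hv : IsHighest σ v ψ) {c : W} {θ : S.GG → 𝔽}
    (hc : ∀ h ∈ C.H0, sigma' C 𝔽 W σ h c = θ h • c) {h₁ h₂ : S.GG} (hh₁ : h₁ ∈ C.H0)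
    (hh₂ : h₂ ∈ C.H0) (h₁θ : θ h₁ ≠ ψ h₁) (h₂θ : θ h₂ ≠ ψ (C.βK * h₂ * C.βK)) :
    c ∈ augmentation σ := by
  obtain ⟨a, ha, x, y, e⟩ := hv.exists_eq_add hd hσ c
  have e₁ := hc h₁ hh₁
  nth_rw 1 [e] at e₁
  rw [map_add, map_add, map_smul, map_smul, hv.eigen _ hh₁, hv.eigen_βK hd hh₁] at e₁
  set b := sigma' C 𝔽 W σ C.βK v with hb
  set a₁ := sigma' C 𝔽 W σ h₁ a - ψ h₁ • a with ha₁
  have hmem₁ : a₁ ∈ augmentation σ :=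
    sub_mem (sigma'_mem_augmentation hd hh₁ ha) (Submodule.smul_mem _ _ ha)
  set t := ψ (C.βK * h₁ * C.βK)
  have e₂ : (θ h₁ - ψ h₁) • c = a₁ + (y * (t - ψ h₁)) • b := by
    rw [sub_smul, ← e₁, e, ha₁]
    module
  have e₃ := congrArg (sigma' C 𝔽 W σ h₂) e₂
  rw [map_add, map_smul, map_smul, hc _ hh₂, hv.eigen_βK hd hh₂] at e₃
  have e₄ : ((θ h₁ - ψ h₁) * (θ h₂ - ψ (C.βK * h₂ * C.βK))) • c =
      sigma' C 𝔽 W σ h₂ a₁ - ψ (C.βK * h₂ * C.βK) • a₁ := by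
    have : ((θ h₁ - ψ h₁) * (θ h₂ - ψ (C.βK * h₂ * C.βK))) • c =
      (θ h₁ - ψ h₁) • θ h₂ • c - ψ (C.βK * h₂ * C.βK) • (θ h₁ - ψ h₁) • c := by module
    rw [this, e₃, e₂]
    module
  rw [← Submodule.smul_mem_iff _ (mul_ne_zero (sub_ne_zero.2 h₁θ) (sub_ne_zero.2 h₂θ)), e₄]
  exact sub_mem (sigma'_mem_augmentation hd hh₂ hmem₁) (Submodule.smul_mem _ _ hmem₁)

/-- Two eigencharacters of highest vectors of a weight agree up to the action of `β_K`. -/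
lemma eigenchar_eq (hd : C.IsLevel d) (hσ : IsWeight C 𝔽 W σ) [Algebra (ZMod S.p) 𝔽]
    (hv : IsHighest σ v ψ) {v' : W} {ψ' : S.GG → 𝔽} (hv' : IsHighest σ v' ψ') :
    (∀ h ∈ C.H0, ψ' h = ψ h) ∨ ∀ h ∈ C.H0, ψ' h = ψ (C.βK * h * C.βK) := by
  by_contra! hcon
  obtain ⟨⟨h₁, hh₁, ne₁⟩, h₂, hh₂, ne₂⟩ := hcon
  have hconj (h : S.GG) : C.βK * (C.βK * h * C.βK) * C.βK = h := by
    rw [← mul_assoc, ← mul_assoc, hd.βK_mul_βK, one_mul, mul_assoc, hd.βK_mul_βK, mul_one]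
  apply augmentation_ne_top hd hσ
  rw [← hv.sup_eq_top hd hσ, eq_comm, sup_eq_left, Submodule.span_le, Set.insert_subset_iff,
    Set.singleton_subset_iff]
  constructor
  · refine hv'.mem_augmentation_of_eigen hd hσ hv.eigen hh₁ (hd.βK_conj_mem_H0 hh₂) ne₁.symm ?_
    rw [hconj]
    exact ne₂.symm
  · refine hv'.mem_augmentation_of_eigen hd hσ (θ := fun h => ψ (C.βK * h * C.βK))
      (fun h hh => hv.eigen_βK hd hh) hh₂ (hd.βK_conj_mem_H0 hh₁) ne₂.symm ?_
    simp only [hconj]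
    exact ne₁.symm

end IsHighest
end Weights

section CompactInduction
open Setting
variable {S : Setting} {C : Chamber S} {d : ℤ} {𝔽 : Type} [Field 𝔽]
  {W : Type} [AddCommGroup W] [Module 𝔽 W] {σ : Representation 𝔽 ↥C.K W}

lemma stdFn_one_apply (w : W) (x : S.GG) :
    stdFn C 𝔽 W σ 1 w x = if x ∈ C.K then sigma' C 𝔽 W σ x w else 0 := by
  by_cases h : x ∈ C.K <;> simp [stdFn, sigma', h]

lemma stdFn_one_mem (w : W) : stdFn C 𝔽 W σ 1 w ∈ IndCarrier C 𝔽 W σ := by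
  refine ⟨fun k hk g => ?_, {1}, fun g hg => ?_⟩
  · rw [stdFn_one_apply, stdFn_one_apply, C.K.mul_mem_cancel_left hk, ← sigma'_of_mem hk]
    split_ifs with h
    · exact sigma'_mul hk h w
    · simp
  · rw [stdFn_one_apply] at hg
    exact ⟨g, by_contra fun h => hg (if_neg h), 1, by simp, by simp⟩

variable (σ) in
/-- The map `w ↦ [1, w]` from `σ` to its compact induction. -/
def indUnit : W →ₗ[𝔽] ↥(IndSub C 𝔽 W σ) where
  toFun w := ⟨stdFn C 𝔽 W σ 1 w, stdFn_one_mem w⟩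
  map_add' v w := Subtype.ext (funext fun x => by
    change stdFn C 𝔽 W σ 1 (v + w) x = stdFn C 𝔽 W σ 1 v x + stdFn C 𝔽 W σ 1 w x
    simp only [stdFn_one_apply]
    split_ifs <;> simp)
  map_smul' c w := Subtype.ext (funext fun x => by
    change stdFn C 𝔽 W σ 1 (c • w) x = c • stdFn C 𝔽 W σ 1 w x
    simp only [stdFn_one_apply]
    split_ifs <;> simp)

lemma indUnit_apply (w : W) (x : S.GG) :
    (indUnit σ w : S.GG → W) x = if x ∈ C.K then sigma' C 𝔽 W σ x w else 0 :=
  stdFn_one_apply w x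

lemma indRep_indUnit {k : S.GG} (hk : k ∈ C.K) (w : W) :
    indRep C 𝔽 W σ k (indUnit σ w) = indUnit σ (sigma' C 𝔽 W σ k w) := by
  refine Subtype.ext (funext fun x => ?_)
  change (indUnit σ w : S.GG → W) (x * k) = _
  rw [indUnit_apply, indUnit_apply, C.K.mul_mem_cancel_right hk]
  split_ifs with h
  · exact sigma'_mul h hk w
  · rfl

lemma eq_zero_of_comp_indUnit {V : Type} [AddCommGroup V] [Module 𝔽 V]
    {ρ : Representation 𝔽 S.GG V} {φ : ↥(IndSub C 𝔽 W σ) →ₗ[𝔽] V}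
    (hφ : ∀ g x, φ (indRep C 𝔽 W σ g x) = ρ g (φ x)) (h0 : ∀ w, φ (indUnit σ w) = 0) :
    φ = 0 := by
  have key (s : Finset S.GG) : ∀ f : ↥(IndSub C 𝔽 W σ),
      (∀ g, (f : S.GG → W) g ≠ 0 → ∃ k ∈ C.K, ∃ t ∈ s, g = k * t) → φ f = 0 := by
    induction s using Finset.induction_on with
    | empty =>
      intro f hf
      have : f = 0 := Subtype.ext (funext fun g => by
        by_contra h
        obtain ⟨_, _, _, ht, _⟩ := hf g h
        simp at ht)
      rw [this, map_zero]
    | insert t s _ ih =>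
      intro f hf
      have hsub (g : S.GG) : ((f - indRep C 𝔽 W σ t⁻¹ (indUnit σ ((f : S.GG → W) t)) :
          ↥(IndSub C 𝔽 W σ)) : S.GG → W) g = (f : S.GG → W) g -
            if g * t⁻¹ ∈ C.K then sigma' C 𝔽 W σ (g * t⁻¹) ((f : S.GG → W) t) else 0 := by
        rw [← indUnit_apply]
        rfl
      have := ih (f - indRep C 𝔽 W σ t⁻¹ (indUnit σ ((f : S.GG → W) t))) (fun g hg => by
        rw [hsub] at hg
        have hgt : g * t⁻¹ ∉ C.K := by
          intro h
          have e := f.2.1 _ h t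
          rw [inv_mul_cancel_right] at e
          rw [if_pos h, e, sigma'_of_mem h, sub_self] at hg
          exact hg rfl
        rw [if_neg hgt, sub_zero] at hg
        obtain ⟨k, hk, t', ht', rfl⟩ := hf g hg
        refine ⟨k, hk, t', (Finset.mem_insert.1 ht').resolve_left ?_, rfl⟩
        rintro rfl
        exact hgt (by simpa using hk))
      rwa [map_sub, hφ, h0, map_zero, sub_zero] at this
  ext f
  obtain ⟨s, hs⟩ := f.2.2
  exact key s f hs

variable {W₂ : Type} [AddCommGroup W₂] [Module 𝔽 W₂] {σ' : Representation 𝔽 ↥C.K W₂}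

/-- The coefficient function `g ↦ (w ↦ φ [1, w] (g))` of a map of compact inductions. -/
def coeff (φ : ↥(IndSub C 𝔽 W σ) →ₗ[𝔽] ↥(IndSub C 𝔽 W₂ σ')) (g : S.GG) : W →ₗ[𝔽] W₂ :=
  LinearMap.proj g ∘ₗ (IndSub C 𝔽 W₂ σ').subtype ∘ₗ φ ∘ₗ indUnit σ

variable {φ : ↥(IndSub C 𝔽 W σ) →ₗ[𝔽] ↥(IndSub C 𝔽 W₂ σ')}

lemma coeff_mul_left {k : S.GG} (hk : k ∈ C.K) (g : S.GG) (w : W) :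
    coeff φ (k * g) w = sigma' C 𝔽 W₂ σ' k (coeff φ g w) := by
  rw [sigma'_of_mem hk]
  exact (φ (indUnit σ w)).2.1 k hk g

lemma coeff_mul_right (hφ : ∀ g x, φ (indRep C 𝔽 W σ g x) = indRep C 𝔽 W₂ σ' g (φ x))
    {k : S.GG} (hk : k ∈ C.K) (g : S.GG) (w : W) :
    coeff φ (g * k) w = coeff φ g (sigma' C 𝔽 W σ k w) := by
  change (indRep C 𝔽 W₂ σ' k (φ (indUnit σ w)) : S.GG → W₂) g =
    (φ (indUnit σ (sigma' C 𝔽 W σ k w)) : S.GG → W₂) g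
  rw [← hφ, indRep_indUnit hk]

lemma exists_coeff_alphaE_pow_ne_zero (hd : C.IsLevel d)
    (hφ : ∀ g x, φ (indRep C 𝔽 W σ g x) = indRep C 𝔽 W₂ σ' g (φ x)) (h0 : φ ≠ 0) :
    ∃ n : ℕ, coeff φ (S.alphaE ^ n) ≠ 0 := by
  by_contra! hcon
  refine h0 (eq_zero_of_comp_indUnit hφ fun w => Subtype.ext (funext fun g => ?_))
  obtain ⟨k₁, hk₁, k₂, hk₂, n, rfl⟩ := hd.cartan g
  change coeff φ _ w = 0
  rw [coeff_mul_right hφ hk₂, coeff_mul_left hk₁, hcon, LinearMap.zero_apply, map_zero]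

lemma coeff_eigen (hd : C.IsLevel d)
    (hφ : ∀ g x, φ (indRep C 𝔽 W σ g x) = indRep C 𝔽 W₂ σ' g (φ x)) (n : ℕ) {v : W}
    {ψ : S.GG → 𝔽} (hv : ∀ h ∈ C.H0, sigma' C 𝔽 W σ h v = ψ h • v) :
    ∀ h ∈ C.H0, sigma' C 𝔽 W₂ σ' h (coeff φ (S.alphaE ^ n) v) =
      ψ h • coeff φ (S.alphaE ^ n) v := by
  intro h hh
  have hK := hd.mem_K_of_mem_H0 hh
  rw [← coeff_mul_left hK, hd.commute_alphaE_pow hh, coeff_mul_right hφ hK, hv h hh, map_smul]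

lemma coeff_fixed (hd : C.IsLevel d) (hσ : IsWeight C 𝔽 W σ)
    (hφ : ∀ g x, φ (indRep C 𝔽 W σ g x) = indRep C 𝔽 W₂ σ' g (φ x)) {n : ℕ} (hn : n ≠ 0) (w : W) :
    ∀ u ∈ S.Nset ∩ C.K, sigma' C 𝔽 W₂ σ' u (coeff φ (S.alphaE ^ n) w) =
      coeff φ (S.alphaE ^ n) w := by
  intro u hu
  have hz := hd.inv_conj_alphaE_pow_mem hn hu
  rw [← coeff_mul_left hu.2,
    show u * S.alphaE ^ n = S.alphaE ^ n * ((S.alphaE ^ n)⁻¹ * u * S.alphaE ^ n) by group,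
    coeff_mul_right hφ hz.1, hσ.sigma'_eq hz]

lemma augmentation_le_ker_coeff (hd : C.IsLevel d) (hσ' : IsWeight C 𝔽 W₂ σ')
    (hφ : ∀ g x, φ (indRep C 𝔽 W σ g x) = indRep C 𝔽 W₂ σ' g (φ x)) {n : ℕ} (hn : n ≠ 0) :
    augmentation σ ≤ LinearMap.ker (coeff φ (S.alphaE ^ n)) := by
  refine augmentation_le fun u hu w => ?_
  have hz := hd.conj_alphaE_pow_mem hn hu
  rw [LinearMap.mem_ker, map_sub, ← coeff_mul_right hφ hu.2,
    show S.alphaE ^ n * u = S.alphaE ^ n * u * (S.alphaE ^ n)⁻¹ * S.alphaE ^ n by group,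
    coeff_mul_left hz.1, hσ'.sigma'_eq hz, sub_self]

lemma IsHighest.exists_of_hom (hd : C.IsLevel d) (hσ : IsWeight C 𝔽 W σ)
    (hσ' : IsWeight C 𝔽 W₂ σ') {v : W} {ψ : S.GG → 𝔽} (hv : IsHighest σ v ψ)
    (hφ : ∀ g x, φ (indRep C 𝔽 W σ g x) = indRep C 𝔽 W₂ σ' g (φ x)) (h0 : φ ≠ 0) :
    ∃ v' : W₂, IsHighest σ' v' ψ ∨ IsHighest σ' v' fun h => ψ (C.βK * h * C.βK) := by
  obtain ⟨n, hn⟩ := exists_coeff_alphaE_pow_ne_zero hd hφ h0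
  rcases eq_or_ne n 0 with rfl | hn0
  · rw [pow_zero] at hn
    refine ⟨coeff φ 1 v, Or.inl ⟨fun h => ?_, fun u hu => ?_, ?_⟩⟩
    · rcases hσ.2.2.1 (LinearMap.ker (coeff φ 1)) (fun k w hw => by
        rw [← sigma'_of_mem k.2, LinearMap.mem_ker, ← coeff_mul_right hφ k.2, one_mul,
          ← mul_one (k : S.GG), coeff_mul_left k.2, LinearMap.mem_ker.1 hw, map_zero]) with hk | hk
      · exact hv.ne_zero (LinearMap.ker_eq_bot'.1 hk v h)
      · exact hn (LinearMap.ker_eq_top.1 hk)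
    · rw [← coeff_mul_left hu.2, mul_one, ← one_mul u, coeff_mul_right hφ hu.2, hv.fixed u hu]
    · simpa using coeff_eigen hd hφ 0 hv.eigen
  · by_cases h : coeff φ (S.alphaE ^ n) v = 0
    swap
    · exact ⟨_, Or.inl ⟨h, coeff_fixed hd hσ hφ hn0 v, coeff_eigen hd hφ n hv.eigen⟩⟩
    refine ⟨coeff φ (S.alphaE ^ n) (sigma' C 𝔽 W σ C.βK v), Or.inr
      ⟨fun h' => hn ?_, coeff_fixed hd hσ hφ hn0 _,
        coeff_eigen hd hφ n fun h hh => hv.eigen_βK hd hh⟩⟩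
    rw [← LinearMap.ker_eq_top, ← top_le_iff, ← hv.sup_eq_top hd hσ, sup_le_iff,
      Submodule.span_le, Set.insert_subset_iff, Set.singleton_subset_iff]
    exact ⟨augmentation_le_ker_coeff hd hσ' hφ hn0, h, h'⟩

end CompactInduction

/-- If `χ_{σ'} ∉ {χ_σ, χ_σ^s}` then `Hom_G(ind_K^G σ, ind_K^G σ') = 0`. -/
theorem stmt8
    (S : Setting) (C : Chamber S)
    (𝔽 : Type) [Field 𝔽] [IsAlgClosed 𝔽] [Algebra (ZMod S.p) 𝔽]
    [Algebra.IsAlgebraic (ZMod S.p) 𝔽]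
    (W : Type) [AddCommGroup W] [Module 𝔽 W]
    (σ : Representation 𝔽 ↥C.K W) (hσ : IsWeight C 𝔽 W σ)
    (v0 : W) (hv0 : v0 ≠ 0) (hv0inv : ∀ g ∈ C.I1, sigma' C 𝔽 W σ g v0 = v0)
    (χ : S.GG → 𝔽) (hχ : IsChi C 𝔽 W σ v0 χ)
    (W' : Type) [AddCommGroup W'] [Module 𝔽 W']
    (σ' : Representation 𝔽 ↥C.K W') (hσ' : IsWeight C 𝔽 W' σ')
    (v0' : W') (hv0' : v0' ≠ 0) (hv0inv' : ∀ g ∈ C.I1, sigma' C 𝔽 W' σ' g v0' = v0')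
    (χ' : S.GG → 𝔽) (hχ' : IsChi C 𝔽 W' σ' v0' χ')
    (hne1 : ∃ h ∈ C.H0, χ' h ≠ χ h)
    (hne2 : ∃ h ∈ C.H0, χ' h ≠ χ (C.βK * h * C.βK)) :
    ∀ φ : ↥(IndSub C 𝔽 W σ) →ₗ[𝔽] ↥(IndSub C 𝔽 W' σ'),
      (∀ g x, φ (indRep C 𝔽 W σ g x) = indRep C 𝔽 W' σ' g (φ x)) → φ = 0 := by
  intro φ hφ
  by_contra h0
  obtain ⟨d, hd⟩ := C.exists_isLevel
  have hI1 : ∀ n ∈ S.Nset ∩ C.K, n ∈ C.I1 := by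
    rintro n ⟨⟨x, y, -, hn⟩, hK⟩
    exact hd.mem_I1 n hK x y hn
  have hv : IsHighest σ v0 χ := ⟨hv0, fun n hn => hv0inv n (hI1 n hn), hχ⟩
  have hv' : IsHighest σ' v0' χ' := ⟨hv0', fun n hn => hv0inv' n (hI1 n hn), hχ'⟩
  obtain ⟨h₁, hh₁, ne₁⟩ := hne1
  obtain ⟨h₂, hh₂, ne₂⟩ := hne2
  obtain ⟨v, hvχ | hvχ⟩ := hv.exists_of_hom hd hσ hσ' hφ h0
  · rcases hvχ.eigenchar_eq hd hσ' hv' with h | h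
    · exact ne₁ (h h₁ hh₁)
    · exact ne₂ (h h₂ hh₂)
  · rcases hvχ.eigenchar_eq hd hσ' hv' with h | h
    · exact ne₂ (h h₂ hh₂)
    · have := h h₁ hh₁
      rw [← mul_assoc, ← mul_assoc, hd.βK_mul_βK, one_mul, mul_assoc, hd.βK_mul_βK,
        mul_one] at this
      exact ne₁ this

end U21
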